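/- arXiv:2302.04673 — 3 statements merged into one kernel-verified Lean document; each statement's English description precedes it below -/
import Mathlib

section
/- A nonsingular point that is not ℝ|ℚ-regular: Let p := x_1³ − 2x_2³ ∈ ℚ[x_1,x_2] and V := {(x_1,x_2) ∈ ℝ² : p(x_1,x_2) = 0}. Then: (i) V = {(2^{1/3}·t, t) : t ∈ ℝ} is a line, hence a nonsingular real algebraic set of dimension 1; (ii) the vanishing ideal I_ℚ(V) ⊆ ℚ[x_1,x_2] is the principal ideal generated by p; (iii) the localization ℝ[x_1,x_2]_{(x_1,x_2)}/(p·ℝ[x_1,x_2]_{(x_1,x_2)}) is not an integral domain and hence not a regular local ring; consequently the origin is not an ℝ|ℚ-regular point of V. -/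
open MvPolynomial

noncomputable section

variable {ι κ : Type*} [Fintype ι] [DecidableEq ι] [Fintype κ]

/-- `V ⊆ ℝ^ι` is a `ℚ`-algebraic set: the common zero set of finitely many
polynomials with rational coefficients. -/
def IsQAlgebraicSet (V : Set (ι → ℝ)) : Prop :=
  ∃ S : Finset (MvPolynomial ι ℚ), V = {x : ι → ℝ | ∀ p ∈ S, aeval x p = 0}

/-- The gradient of a polynomial with rational coefficients at a real point. -/
def polyGradQ (p : MvPolynomial ι ℚ) (a : ι → ℝ) : ι → ℝ :=
  fun i => aeval a (pderiv i p)

/-- `V` is a `d`-dimensional `C^∞` submanifold of `ℝ^ι`: near each of its points it is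
the regular zero set of a `C^∞` submersion with values in `ℝ^(card ι - d)`. -/
def IsSmoothSubmanifold (d : ℕ) (V : Set (ι → ℝ)) : Prop :=
  ∀ a ∈ V, ∃ (U : Set (ι → ℝ)) (f : (ι → ℝ) → (Fin (Fintype.card ι - d) → ℝ)),
    IsOpen U ∧ a ∈ U ∧ ContDiffOn ℝ (⊤ : ℕ∞) f U ∧
    (∀ x ∈ U, Function.Surjective (fderiv ℝ f x)) ∧
    V ∩ U = {x ∈ U | f x = 0}

/-- `V` is a `ℚ`-nonsingular `ℚ`-algebraic set of dimension `d`. -/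
def IsQNonsingular (d : ℕ) (V : Set (ι → ℝ)) : Prop :=
  IsQAlgebraicSet V ∧ IsSmoothSubmanifold d V ∧
    ∀ a ∈ V, ∃ q : Fin (Fintype.card ι - d) → MvPolynomial ι ℚ,
      (∀ j, ∀ x ∈ V, aeval x (q j) = 0) ∧
      LinearIndependent ℝ (fun j => polyGradQ (q j) a) ∧
      ∃ U : Set (ι → ℝ), IsOpen U ∧ a ∈ U ∧
        V ∩ U = {x ∈ U | ∀ j, aeval x (q j) = 0}

/-- A real polynomial is overt if the zero set of its top-degree homogeneous
component is contained in `{0}`. -/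
def IsOvert (p : MvPolynomial ι ℝ) : Prop :=
  ∀ x : ι → ℝ, eval x (homogeneousComponent p.totalDegree p) = 0 → x = 0

/-- `V` is projectively `ℚ`-closed: the zero set of a single overt polynomial with
rational coefficients. -/
def IsProjQClosed (V : Set (ι → ℝ)) : Prop :=
  ∃ p : MvPolynomial ι ℚ, IsOvert (MvPolynomial.map (algebraMap ℚ ℝ) p) ∧
    V = {x : ι → ℝ | aeval x p = 0}

/-- `V ⊆ ℝ^ι` is a real algebraic set. -/
def IsRAlgebraicSet (V : Set (ι → ℝ)) : Prop :=
  ∃ S : Finset (MvPolynomial ι ℝ), V = {x : ι → ℝ | ∀ p ∈ S, eval x p = 0}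

/-- The gradient of a real polynomial at a point. -/
def polyGradR (p : MvPolynomial ι ℝ) (a : ι → ℝ) : ι → ℝ :=
  fun i => eval a (pderiv i p)

/-- `V` is a nonsingular real algebraic set of dimension `d`. -/
def IsNonsingularRAlgebraic (d : ℕ) (V : Set (ι → ℝ)) : Prop :=
  IsRAlgebraicSet V ∧ IsSmoothSubmanifold d V ∧
    ∀ a ∈ V, ∃ q : Fin (Fintype.card ι - d) → MvPolynomial ι ℝ,
      (∀ j, ∀ x ∈ V, eval x (q j) = 0) ∧
      LinearIndependent ℝ (fun j => polyGradR (q j) a) ∧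
      ∃ U : Set (ι → ℝ), IsOpen U ∧ a ∈ U ∧
        V ∩ U = {x ∈ U | ∀ j, eval x (q j) = 0}

/-- The tangent space of `M` at `a`, realized as the span of the tangent cone. -/
def tangentSpan (M : Set (ι → ℝ)) (a : ι → ℝ) : Submodule ℝ (ι → ℝ) :=
  Submodule.span ℝ (tangentConeAt ℝ M a)

/-- The submanifolds `Ms i` of `M`, of codimensions `c i`, are in general position. -/
def InGeneralPosition {ℓ : ℕ} (M : Set (ι → ℝ)) (Ms : Fin ℓ → Set (ι → ℝ))
    (c : Fin ℓ → ℕ) : Prop :=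
  ∀ α : Finset (Fin ℓ), α.Nonempty → ∀ a : ι → ℝ, (∀ i ∈ α, a ∈ Ms i) →
    Module.finrank ℝ ↥(⨅ i ∈ α, tangentSpan (Ms i) a) + ∑ i ∈ α, c i
      = Module.finrank ℝ ↥(tangentSpan M a)

/-- A `ℚ`-regular map on `S`: each component is a quotient of polynomials with
rational coefficients whose denominator does not vanish on `S`. -/
def IsQRegularMap (S : Set (ι → ℝ)) (g : (ι → ℝ) → κ → ℝ) : Prop :=
  ∀ j : κ, ∃ p q : MvPolynomial ι ℚ, (∀ x ∈ S, aeval x q ≠ 0) ∧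
    ∀ x ∈ S, g x j = aeval x p / aeval x q

/-- A map whose components are restrictions of polynomials with rational coefficients. -/
def IsQPolynomialMap {κ' : Type*} (S : Set (ι → ℝ)) (g : (ι → ℝ) → κ' → ℝ) : Prop :=
  ∀ j : κ', ∃ p : MvPolynomial ι ℚ, ∀ x ∈ S, g x j = aeval x p

/-- `f` restricts to a `C^∞` diffeomorphism from `A` onto `B`. -/
def IsSmoothDiffeoOn (f : (ι → ℝ) → κ → ℝ) (A : Set (ι → ℝ)) (B : Set (κ → ℝ)) : Prop :=
  Set.BijOn f A B ∧ ContDiffOn ℝ (⊤ : ℕ∞) f A ∧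
    ∃ g : (κ → ℝ) → ι → ℝ, ContDiffOn ℝ (⊤ : ℕ∞) g B ∧ Set.InvOn g f A B

/-- `L` is a `ℚ`-nice `ℚ`-algebraic set. -/
def IsQNice (L : Set (ι → ℝ)) : Prop :=
  ∀ a ∈ L, ∃ U : Set (ι → ℝ), IsOpen U ∧ a ∈ U ∧
    ∀ f : (ι → ℝ) → ℝ, ContDiff ℝ (⊤ : ℕ∞) f → (∀ x ∈ L, f x = 0) →
      ∃ (s : ℕ) (pp : Fin s → MvPolynomial ι ℚ) (u : Fin s → (ι → ℝ) → ℝ),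
        (∀ i, ∀ x ∈ L, aeval x (pp i) = 0) ∧
        (∀ i, ContDiffOn ℝ (⊤ : ℕ∞) (u i) U) ∧
        ∀ x ∈ U, f x = ∑ i, u i x * aeval x (pp i)

/-- Inclusion `ℝ^a ⊆ ℝ^b` via the first `a` coordinates. -/
def inclZero {a b : ℕ} (_ : a ≤ b) (x : Fin a → ℝ) : Fin b → ℝ :=
  fun j => if hj : (j : ℕ) < a then x ⟨j, hj⟩ else 0

/-- Reading a point of `ℝ^(k×k)` as a `k × k` matrix. -/
def matOf {k : ℕ} (x : Fin k × Fin k → ℝ) : Matrix (Fin k) (Fin k) ℝ :=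
  Matrix.of fun i j => x (i, j)

/-- The symmetric idempotent matrices of size `k` and trace `r`. -/
def GrassMatrix (k r : ℕ) : Set (Matrix (Fin k) (Fin k) ℝ) :=
  {X | X.transpose = X ∧ X * X = X ∧ X.trace = (r : ℝ)}

/-- The Grassmannian `G_{m,n}` embedded in `ℝ^{(m+n)²}`. -/
def Grass (m n : ℕ) : Set (Fin (m + n) × Fin (m + n) → ℝ) :=
  {x | matOf x ∈ GrassMatrix (m + n) m}

/-- The diagonal matrix `D_ℓ` with `1` in the first `ℓ` diagonal entries and `0` elsewhere. -/
def stdProj (k ℓ : ℕ) : Matrix (Fin k) (Fin k) ℝ :=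
  Matrix.diagonal fun i => if (i : ℕ) < ℓ then 1 else 0

/-- The coordinate subspace `ℝ^ℓ ⊆ ℝ^k` (first `ℓ` coordinates). -/
def coordSubspace (k ℓ : ℕ) : Submodule ℝ (Fin k → ℝ) :=
  ⨅ i ∈ {i : Fin k | ℓ ≤ (i : ℕ)},
    LinearMap.ker (LinearMap.proj (R := ℝ) (φ := fun _ : Fin k => ℝ) i)

/-- The column space of a square matrix. -/
def colSpace {k : ℕ} (X : Matrix (Fin k) (Fin k) ℝ) : Submodule ℝ (Fin k → ℝ) :=
  LinearMap.range X.mulVecLin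

/-- `lam` is a partition inside the `m × n` rectangle. -/
def IsPartitionIn (n : ℕ) {m : ℕ} (lam : Fin m → ℕ) : Prop :=
  (∀ k, lam k ≤ n) ∧ Antitone lam

/-- The Schubert variety `σ_λ ⊆ G_{m,n}` with respect to the canonical complete flag. -/
def SchubertVariety (m n : ℕ) (lam : Fin m → ℕ) :
    Set (Fin (m + n) × Fin (m + n) → ℝ) :=
  {x | x ∈ Grass m n ∧ ∀ k : Fin m,
    ((matOf x - 1) * stdProj (m + n) (n + ((k : ℕ) + 1) - lam k)).rank ≤ n - lam k}

/-- `λ_{k+1}`, with the convention `λ_{m+1} = 0`. -/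
def lamNext {m : ℕ} (lam : Fin m → ℕ) (k : Fin m) : ℕ :=
  if h : (k : ℕ) + 1 < m then lam ⟨(k : ℕ) + 1, h⟩ else 0

/-- The open Schubert cell `Ω_λ ⊆ G_{m,n}` with respect to the canonical complete flag. -/
def SchubertCell (m n : ℕ) (lam : Fin m → ℕ) :
    Set (Fin (m + n) × Fin (m + n) → ℝ) :=
  {x | x ∈ Grass m n ∧ ∀ k : Fin m, ∀ ℓ : ℕ,
    n + ((k : ℕ) + 1) - lam k ≤ ℓ → ℓ ≤ n + ((k : ℕ) + 1) - lamNext lam k →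
    Module.finrank ℝ ↥(colSpace (matOf x) ⊓ coordSubspace (m + n) ℓ) = (k : ℕ) + 1}

/-- `f 0 + ⋯ + f (t-1)` for `f : Fin c → ℕ`. -/
def partialSum {c : ℕ} (f : Fin c → ℕ) (t : ℕ) : ℕ :=
  ∑ i ∈ Finset.univ.filter (fun i : Fin c => (i : ℕ) < t), f i

/-- The `j`-th matrix slot of a point of `(ℝ^{k×k})^c`. -/
def matSlot {c k : ℕ} (z : Fin c × (Fin k × Fin k) → ℝ) (j : Fin c) :
    Matrix (Fin k) (Fin k) ℝ :=
  Matrix.of fun p q => z (j, (p, q))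

/-- The embedded Bott–Samelson set `Z_λ`, with slot `0` carrying `X` and slot `k`
(`1 ≤ k ≤ c-1`) carrying `Y_k`. -/
def BottSamelson (m n c : ℕ) (hc : 0 < c) (a b : Fin c → ℕ) :
    Set (Fin c × (Fin (m + n) × Fin (m + n)) → ℝ) :=
  {z | matSlot z ⟨0, hc⟩ ∈ GrassMatrix (m + n) m ∧
    (∀ j : Fin c, 0 < (j : ℕ) →
      matSlot z j ∈ GrassMatrix (m + n) (partialSum a (j : ℕ)) ∧
      matSlot z j * stdProj (m + n) (partialSum a (j : ℕ) + partialSum b (j : ℕ))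
        = matSlot z j) ∧
    (∀ (j : Fin c), 0 < (j : ℕ) → ∀ (h2 : (j : ℕ) + 1 < c),
      matSlot z ⟨(j : ℕ) + 1, h2⟩ * matSlot z j = matSlot z j) ∧
    (∀ j : Fin c, 0 < (j : ℕ) → (j : ℕ) = c - 1 →
      matSlot z ⟨0, hc⟩ * matSlot z j = matSlot z j)}

end
/-- The polynomial `x₁³ - 2x₂³` over `ℚ`. -/
noncomputable def cubicPoly : MvPolynomial (Fin 2) ℚ := X 0 ^ 3 - C 2 * X 1 ^ 3

/-- The same polynomial viewed over `ℝ`. -/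
noncomputable def cubicPolyR : MvPolynomial (Fin 2) ℝ := MvPolynomial.map (algebraMap ℚ ℝ) cubicPoly

/-- The real zero set `V` of `x₁³ - 2x₂³`. -/
def cubicSet : Set (Fin 2 → ℝ) := {x | aeval x cubicPoly = 0}

/-- The maximal ideal `𝔫₀` of real polynomials vanishing at the origin. -/
noncomputable def originIdeal : Ideal (MvPolynomial (Fin 2) ℝ) :=
  RingHom.ker (eval (fun _ : Fin 2 => (0 : ℝ)))

instance : originIdeal.IsPrime := by
  have hs : Function.Surjective (eval (fun _ : Fin 2 => (0 : ℝ))) :=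
    fun r => ⟨C r, by simp⟩
  exact (RingHom.ker_isMaximal_of_surjective _ hs).isPrime

/-- A commutative ring is a regular local ring if it is local and its maximal ideal
(the Jacobson radical) is generated by Krull-dimension many elements. -/
def IsRegularLocal (R : Type*) [CommRing R] : Prop :=
  IsLocalRing R ∧ ∃ s : Finset R, Ideal.span (s : Set R) = (⊥ : Ideal R).jacobson ∧
    (s.card : WithBot (WithTop ℕ)) = ringKrullDim R

namespace CubicLine

open scoped nonZeroDivisors

lemma cbrt_two_pow : ((2 : ℝ) ^ ((1 : ℝ) / 3)) ^ 3 = 2 := by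
  rw [← Real.rpow_natCast, ← Real.rpow_mul (by norm_num)]
  norm_num

lemma aeval_cubicPoly (x : Fin 2 → ℝ) : aeval x cubicPoly = x 0 ^ 3 - 2 * x 1 ^ 3 := by
  simp [cubicPoly]

lemma cubicPolyR_eq : cubicPolyR = X 0 ^ 3 - C 2 * X 1 ^ 3 := by
  simp [cubicPolyR, cubicPoly]

lemma mem_cubicSet_iff {a : ℝ} (ha : a ^ 3 = 2) (x : Fin 2 → ℝ) :
    x ∈ cubicSet ↔ x 0 = a * x 1 := by
  change aeval x cubicPoly = 0 ↔ _
  rw [aeval_cubicPoly, ← ha, ← mul_pow, sub_eq_zero]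
  exact (Odd.strictMono_pow (R := ℝ) (by decide : Odd 3)).injective.eq_iff

lemma cubicSet_eq_line : cubicSet = {x | ∃ t : ℝ, x = fun i : Fin 2 =>
    if i = 0 then (2 : ℝ) ^ ((1 : ℝ) / 3) * t else t} := by
  ext x
  rw [mem_cubicSet_iff cbrt_two_pow]
  constructor
  · intro h
    refine ⟨x 1, funext fun i => ?_⟩
    fin_cases i
    · simpa using h
    · simp
  · rintro ⟨t, rfl⟩
    simp

/-- The linear form `x₀ - a x₁`. -/
noncomputable def linForm (a : ℝ) : MvPolynomial (Fin 2) ℝ := X 0 - C a * X 1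

/-- The quadratic form `x₀² + a x₀ x₁ + a² x₁²`. -/
noncomputable def quadForm (a : ℝ) : MvPolynomial (Fin 2) ℝ :=
  X 0 ^ 2 + C a * X 0 * X 1 + C a ^ 2 * X 1 ^ 2

lemma cubicPolyR_eq_mul {a : ℝ} (ha : a ^ 3 = 2) : cubicPolyR = linForm a * quadForm a := by
  rw [cubicPolyR_eq, ← ha, linForm, quadForm, C_pow]
  ring

lemma isNonsingularRAlgebraic_cubicSet : IsNonsingularRAlgebraic 1 cubicSet := by
  obtain ⟨a, ha⟩ : ∃ a : ℝ, a ^ 3 = 2 := ⟨_, cbrt_two_pow⟩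
  have hsub : Subsingleton (Fin (Fintype.card (Fin 2) - 1)) := by
    rw [Fintype.card_fin]
    exact inferInstanceAs (Subsingleton (Fin 1))
  let j₀ : Fin (Fintype.card (Fin 2) - 1) := ⟨0, by simp⟩
  refine ⟨⟨{cubicPolyR}, ?_⟩, ?_, ?_⟩
  · ext x
    change aeval x cubicPoly = 0 ↔ _
    simp [aeval_cubicPoly, cubicPolyR_eq]
  · intro b _
    let L : (Fin 2 → ℝ) →L[ℝ] (Fin (Fintype.card (Fin 2) - 1) → ℝ) :=
      ContinuousLinearMap.pi fun _ =>
        ContinuousLinearMap.proj (R := ℝ) (φ := fun _ : Fin 2 => ℝ) 0 -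
          a • ContinuousLinearMap.proj (R := ℝ) (φ := fun _ : Fin 2 => ℝ) 1
    have hL : ∀ x j, L x j = x 0 - a * x 1 := fun x j => by simp [L]
    refine ⟨Set.univ, L, isOpen_univ, trivial, L.contDiff.contDiffOn, ?_, ?_⟩
    · intro x _
      rw [L.fderiv]
      refine fun y => ⟨![y j₀, 0], funext fun j => ?_⟩
      rw [hL, Subsingleton.elim j j₀]
      simp
    · ext x
      simp only [Set.inter_univ, Set.mem_univ, true_and, Set.mem_ofPred_eq, mem_cubicSet_iff ha]
      constructor
      · intro h
        funext j
        rw [hL, h]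
        simp
      · intro h
        have := congrFun h j₀
        rw [hL] at this
        simpa [sub_eq_zero] using this
  · intro b _
    have hev : ∀ x : Fin 2 → ℝ, eval x (linForm a) = x 0 - a * x 1 := fun x => by simp [linForm]
    refine ⟨fun _ => linForm a, fun j x hx => ?_, ?_, Set.univ, isOpen_univ, trivial, ?_⟩
    · rw [hev, (mem_cubicSet_iff ha x).1 hx, sub_self]
    · rw [linearIndependent_subsingleton_index_iff]
      intro _ h
      have := congrFun h 0
      simp [polyGradR, linForm, pderiv_X] at this
    · ext x
      simp only [Set.inter_univ, Set.mem_univ, true_and, Set.mem_ofPred_eq, mem_cubicSet_iff ha,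
        hev, sub_eq_zero]
      exact ⟨fun h _ => h, fun h => h j₀⟩

/-- Division with remainder by `x₀³ - 2x₁³`, with respect to the variable `x₀`. -/
lemma exists_cubic_remainder (q : MvPolynomial (Fin 2) ℚ) :
    ∃ (h : MvPolynomial (Fin 2) ℚ) (u v w : Polynomial ℚ),
      q = cubicPoly * h + Polynomial.aeval (X 1) u + Polynomial.aeval (X 1) v * X 0 +
        Polynomial.aeval (X 1) w * X 0 ^ 2 := by
  induction q using MvPolynomial.induction_on with
  | C r => exact ⟨0, Polynomial.C r, 0, 0, by simp [MvPolynomial.algebraMap_eq]⟩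
  | add p q hp hq =>
    obtain ⟨h, u, v, w, hp⟩ := hp
    obtain ⟨h', u', v', w', hq⟩ := hq
    refine ⟨h + h', u + u', v + v', w + w', ?_⟩
    rw [hp, hq]
    simp only [map_add]
    ring
  | mul_X p i hp =>
    obtain ⟨h, u, v, w, hp⟩ := hp
    fin_cases i
    · refine ⟨h * X 0 + Polynomial.aeval (X 1) w, Polynomial.C 2 * Polynomial.X ^ 3 * w, u, v, ?_⟩
      rw [hp]
      simp [cubicPoly, MvPolynomial.algebraMap_eq]
      ring
    · refine ⟨h * X 1, u * Polynomial.X, v * Polynomial.X, w * Polynomial.X, ?_⟩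
      rw [hp]
      simp
      ring

lemma irreducible_X_pow_three_sub_two :
    Irreducible (Polynomial.X ^ 3 - Polynomial.C 2 : Polynomial ℚ) := by
  refine X_pow_sub_C_irreducible_of_prime Nat.prime_three fun b hb => ?_
  have hint : IsIntegral ℤ b := by
    refine IsIntegral.of_pow (n := 3) (by norm_num) ?_
    rw [hb]
    exact_mod_cast (isIntegral_algebraMap (R := ℤ) (A := ℚ) (x := 2))
  obtain ⟨n, rfl⟩ := IsIntegrallyClosed.isIntegral_iff.1 hint
  have hn : n ^ 3 = 2 := by
    have : ((n : ℚ)) ^ 3 = 2 := by simpa using hb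
    exact_mod_cast this
  have h1 : 1 ≤ n := by nlinarith [sq_nonneg n]
  have h2 : n < 2 := by nlinarith [sq_nonneg n]
  obtain rfl : n = 1 := by omega
  norm_num at hn

lemma eq_zero_of_cubic_root_relation {a : ℝ} (ha : a ^ 3 = 2) {r s t : ℚ}
    (h : (r : ℝ) + s * a + t * a ^ 2 = 0) : r = 0 ∧ s = 0 ∧ t = 0 := by
  let f : Polynomial ℚ :=
    Polynomial.C t * Polynomial.X ^ 2 + Polynomial.C s * Polynomial.X + Polynomial.C r
  have hf : Polynomial.aeval a f = 0 := by
    simp [f]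
    linarith
  have hdvd : (Polynomial.X ^ 3 - Polynomial.C 2 : Polynomial ℚ) ∣ f := by
    rw [minpoly.eq_of_irreducible_of_monic irreducible_X_pow_three_sub_two
      (x := a) (by simp [ha]) (Polynomial.monic_X_pow_sub_C _ (by norm_num))]
    exact minpoly.dvd ℚ a hf
  have hf0 : f = 0 := by
    refine Polynomial.eq_zero_of_dvd_of_degree_lt hdvd ?_
    rw [Polynomial.degree_X_pow_sub_C (by norm_num)]
    exact Polynomial.degree_quadratic_lt
  refine ⟨?_, ?_, ?_⟩
  · simpa [f] using congrArg (Polynomial.coeff · 0) hf0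
  · simpa [f, Polynomial.coeff_X, Polynomial.coeff_C] using congrArg (Polynomial.coeff · 1) hf0
  · simpa [f, Polynomial.coeff_X, Polynomial.coeff_C] using congrArg (Polynomial.coeff · 2) hf0

lemma vanishing_iff_mem_span (q : MvPolynomial (Fin 2) ℚ) :
    (∀ x ∈ cubicSet, aeval x q = 0) ↔ q ∈ Ideal.span {cubicPoly} := by
  obtain ⟨a, ha⟩ : ∃ a : ℝ, a ^ 3 = 2 := ⟨_, cbrt_two_pow⟩
  rw [Ideal.mem_span_singleton]
  constructor
  · intro hq
    obtain ⟨h, u, v, w, rfl⟩ := exists_cubic_remainder q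
    have hline : ∀ t : ℝ, Polynomial.aeval t u + Polynomial.aeval t v * (a * t) +
        Polynomial.aeval t w * (a * t) ^ 2 = 0 := by
      intro t
      have hmem : ![a * t, t] ∈ cubicSet := (mem_cubicSet_iff ha _).2 (by simp)
      have h0 : aeval ![a * t, t] cubicPoly = 0 := hmem
      simpa [h0, ← Polynomial.aeval_algHom_apply] using hq _ hmem
    have hpoly : u.map (algebraMap ℚ ℝ) +
        Polynomial.C a * (v * Polynomial.X).map (algebraMap ℚ ℝ) +
        Polynomial.C (a ^ 2) * (w * Polynomial.X ^ 2).map (algebraMap ℚ ℝ) = 0 := by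
      refine Polynomial.funext fun t => ?_
      have := hline t
      simp only [Polynomial.eval_add, Polynomial.eval_mul, Polynomial.eval_C,
        Polynomial.eval_map_algebraMap, map_mul, map_pow, Polynomial.aeval_X,
        Polynomial.eval_pow,
        Polynomial.eval_zero]
      linarith
    have hcoeff : ∀ n, u.coeff n = 0 ∧ (v * Polynomial.X).coeff n = 0 ∧
        (w * Polynomial.X ^ 2).coeff n = 0 := by
      intro n
      refine eq_zero_of_cubic_root_relation ha ?_
      have := congrArg (Polynomial.coeff · n) hpoly
      simp only [Polynomial.coeff_add, Polynomial.coeff_C_mul, Polynomial.coeff_map,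
        Polynomial.coeff_zero, eq_ratCast] at this
      linarith
    have hu : u = 0 := Polynomial.ext fun n => (hcoeff n).1
    have hv : v = 0 := Polynomial.ext fun n => by
      simpa using (hcoeff (n + 1)).2.1
    have hw : w = 0 := Polynomial.ext fun n => by
      simpa using (hcoeff (n + 2)).2.2
    simp [hu, hv, hw]
  · rintro ⟨h, rfl⟩ x hx
    have h0 : aeval x cubicPoly = 0 := hx
    simp [h0]

/-- The local ring `ℝ[x₀, x₁]_{(x₀, x₁)}` of the plane at the origin. -/
abbrev OriginRing : Type := Localization.AtPrime originIdeal

/-- The quotient of the local ring of the plane at the origin by the cubic polynomial. -/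
abbrev CubicRing : Type :=
  OriginRing ⧸ Ideal.span {algebraMap (MvPolynomial (Fin 2) ℝ) OriginRing cubicPolyR}

/-- The algebra of first-order jets at the origin of the plane. -/
abbrev JetRing : Type := TrivSqZeroExt ℝ (Fin 2 → ℝ)

/-- The first-order jet at the origin of a polynomial. -/
noncomputable def polyJet : MvPolynomial (Fin 2) ℝ →ₐ[ℝ] JetRing :=
  aeval fun i => TrivSqZeroExt.inr (Pi.single i 1)

@[simp] lemma polyJet_X (i : Fin 2) : polyJet (X i) = TrivSqZeroExt.inr (Pi.single i 1) := by
  simp [polyJet]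

lemma fst_polyJet (f : MvPolynomial (Fin 2) ℝ) : (polyJet f).fst = eval (fun _ => 0) f := by
  have : (TrivSqZeroExt.fstHom ℝ ℝ (Fin 2 → ℝ)).comp polyJet =
      aeval (fun _ : Fin 2 => (0 : ℝ)) := by
    ext i
    simp
  simpa [aeval_eq_eval] using DFunLike.congr_fun this f

lemma isUnit_polyJet (f : originIdeal.primeCompl) :
    IsUnit (polyJet (f : MvPolynomial (Fin 2) ℝ)) := by
  rw [TrivSqZeroExt.isUnit_iff_isUnit_fst, fst_polyJet, isUnit_iff_ne_zero]
  exact f.2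

/-- The first-order jet at the origin of a germ of a rational function. -/
noncomputable def jet : OriginRing →+* JetRing :=
  IsLocalization.lift (M := originIdeal.primeCompl) (g := polyJet.toRingHom) isUnit_polyJet

@[simp] lemma jet_algebraMap (f : MvPolynomial (Fin 2) ℝ) :
    jet (algebraMap _ OriginRing f) = polyJet f :=
  IsLocalization.lift_eq _ _

lemma polyJet_cubicPolyR : polyJet cubicPolyR = 0 := by
  simp [cubicPolyR_eq, pow_succ]

/-- The first-order jet at the origin, on the local ring of the cubic. -/
noncomputable def quotJet :
    CubicRing →+* JetRing :=
  Ideal.Quotient.lift _ jet fun f hf => by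
    obtain ⟨g, rfl⟩ := Ideal.mem_span_singleton.1 hf
    rw [map_mul, jet_algebraMap, polyJet_cubicPolyR, zero_mul]

lemma cubicPolyR_ne_zero : cubicPolyR ≠ 0 := by
  intro h
  have := congrArg (eval ![1, 0]) h
  simp [cubicPolyR_eq] at this

lemma algebraMap_originRing_injective :
    Function.Injective (algebraMap (MvPolynomial (Fin 2) ℝ) OriginRing) :=
  IsLocalization.injective _ originIdeal.primeCompl_le_nonZeroDivisors

lemma not_isUnit_of_eval_eq_zero {f : MvPolynomial (Fin 2) ℝ} (hf : eval (fun _ => 0) f = 0) :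
    ¬ IsUnit (algebraMap _ OriginRing f) := by
  intro h
  have := h.map jet
  rw [jet_algebraMap, TrivSqZeroExt.isUnit_iff_isUnit_fst, fst_polyJet, hf] at this
  exact not_isUnit_zero this

/-- A factorization into two nonzero nonunits gives zero divisors in the quotient. -/
lemma not_isDomain_quotient_of_mul {A : Type*} [CommRing A] [IsDomain A] {p l q : A}
    (hp : p = l * q) (hp0 : p ≠ 0) (hl : ¬ IsUnit l) (hq : ¬ IsUnit q) :
    ¬ IsDomain (A ⧸ Ideal.span {p}) := by
  intro h
  have hprime : Prime p := by
    rw [← Ideal.span_singleton_prime hp0]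
    exact (Ideal.Quotient.isDomain_iff_prime _).1 h
  exact (hprime.irreducible.isUnit_or_isUnit hp).elim hl hq

lemma not_isDomain_cubic : ¬ IsDomain CubicRing := by
  obtain ⟨a, ha⟩ : ∃ a : ℝ, a ^ 3 = 2 := ⟨_, cbrt_two_pow⟩
  refine not_isDomain_quotient_of_mul (l := algebraMap _ _ (linForm a))
    (q := algebraMap _ _ (quadForm a)) ?_ ?_ ?_ ?_
  · rw [← map_mul, ← cubicPolyR_eq_mul ha]
  · rw [Ne, map_eq_zero_iff _ algebraMap_originRing_injective]
    exact cubicPolyR_ne_zero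
  · exact not_isUnit_of_eval_eq_zero (by simp [linForm])
  · exact not_isUnit_of_eval_eq_zero (by simp [quadForm])

lemma ringKrullDim_originRing_le : ringKrullDim OriginRing ≤ 2 := by
  rw [IsLocalization.AtPrime.ringKrullDim_eq_height originIdeal OriginRing]
  refine (Ideal.height_le_ringKrullDim_of_ne_top Ideal.IsPrime.ne_top').trans ?_
  rw [MvPolynomial.ringKrullDim_of_isNoetherianRing, ringKrullDim_eq_zero_of_field]
  simp

lemma ringKrullDim_cubic_le_one : ringKrullDim CubicRing ≤ 1 := by
  have hmem : algebraMap (MvPolynomial (Fin 2) ℝ) OriginRing cubicPolyR ∈ OriginRing⁰ := by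
    rw [mem_nonZeroDivisors_iff_ne_zero, Ne, map_eq_zero_iff _ algebraMap_originRing_injective]
    exact cubicPolyR_ne_zero
  have h : _ + 1 ≤ (1 + 1 : WithBot ℕ∞) :=
    (ringKrullDim_quotient_succ_le_of_nonZeroDivisor hmem).trans
      (ringKrullDim_originRing_le.trans_eq one_add_one_eq_two.symm)
  exact ENat.WithBot.add_le_add_one_right_iff.1 h

/-- If a ring maps to the jet ring and hits the jets of both coordinates, then no element with
jet vanishing at the origin generates an ideal containing preimages of both. -/
lemma not_mem_span_singleton_of_jet {R : Type*} [CommRing R] (φ : R →+* JetRing) {x y g : R}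
    (hx : φ x = TrivSqZeroExt.inr (Pi.single 0 1)) (hy : φ y = TrivSqZeroExt.inr (Pi.single 1 1))
    (hg : (φ g).fst = 0) : ¬ (x ∈ Ideal.span {g} ∧ y ∈ Ideal.span {g}) := by
  simp only [Ideal.mem_span_singleton]
  rintro ⟨⟨r, rfl⟩, ⟨s, rfl⟩⟩
  rw [map_mul] at hx hy
  have hx0 := congrFun (congrArg TrivSqZeroExt.snd hx) 0
  have hx1 := congrFun (congrArg TrivSqZeroExt.snd hx) 1
  have hy1 := congrFun (congrArg TrivSqZeroExt.snd hy) 1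
  simp [hg] at hx0 hx1 hy1
  rcases hx1 with h | h <;> simp [h] at hx0 hy1

lemma mem_maximalIdeal_iff_fst_eq_zero {R : Type*} [CommRing R] [IsLocalRing R]
    (φ : R →+* JetRing) (hφ : Function.Surjective fun x => (φ x).fst) (x : R) :
    x ∈ IsLocalRing.maximalIdeal R ↔ (φ x).fst = 0 := by
  let ψ : R →+* ℝ := (TrivSqZeroExt.fstHom ℝ ℝ (Fin 2 → ℝ)).toRingHom.comp φ
  have : (RingHom.ker ψ).IsMaximal := RingHom.ker_isMaximal_of_surjective ψ hφ
  rw [← IsLocalRing.eq_maximalIdeal this]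
  rfl

/-- A ring of Krull dimension at most one whose first-order jets include those of the constants
and of both coordinates is not a regular local ring. -/
lemma not_isRegularLocal_of_jet {R : Type*} [CommRing R] (hdim : ringKrullDim R ≤ 1)
    (φ : R →+* JetRing) (hφ : Function.Surjective fun x => (φ x).fst) {x y : R}
    (hx : φ x = TrivSqZeroExt.inr (Pi.single 0 1)) (hy : φ y = TrivSqZeroExt.inr (Pi.single 1 1)) :
    ¬ IsRegularLocal R := by
  rintro ⟨hloc, s, hs, hcard⟩
  rw [IsLocalRing.jacobson_eq_maximalIdeal _ bot_ne_top] at hs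
  have hcard1 : s.card ≤ 1 := by
    have h : ((s.card : ℕ) : WithBot ℕ∞) ≤ 1 := hcard.trans_le hdim
    exact_mod_cast h
  obtain ⟨g, hg⟩ : ∃ g, IsLocalRing.maximalIdeal R = Ideal.span {g} := by
    obtain ⟨g, hg⟩ := Finset.card_le_one_iff_subset_singleton.1 hcard1
    rcases Finset.subset_singleton_iff.1 hg with rfl | rfl
    · exact ⟨0, by simp [← hs]⟩
    · exact ⟨g, by simp [← hs]⟩
  have hmax := mem_maximalIdeal_iff_fst_eq_zero φ hφ
  refine not_mem_span_singleton_of_jet φ hx hy ((hmax g).1 ?_) ⟨?_, ?_⟩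
  · rw [hg]
    exact Ideal.mem_span_singleton_self g
  · rw [← hg, hmax, hx, TrivSqZeroExt.fst_inr]
  · rw [← hg, hmax, hy, TrivSqZeroExt.fst_inr]

/-- The class of a polynomial in the local ring of the cubic at the origin. -/
noncomputable def polyToCubicRing : MvPolynomial (Fin 2) ℝ →+* CubicRing :=
  (Ideal.Quotient.mk _).comp (algebraMap _ OriginRing)

lemma quotJet_polyToCubicRing (f : MvPolynomial (Fin 2) ℝ) :
    quotJet (polyToCubicRing f) = polyJet f :=
  jet_algebraMap f

lemma not_isRegularLocal_cubic : ¬ IsRegularLocal CubicRing := by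
  refine not_isRegularLocal_of_jet ringKrullDim_cubic_le_one quotJet (fun r => ?_)
    (x := polyToCubicRing (X 0)) (y := polyToCubicRing (X 1)) ?_ ?_
  · refine ⟨polyToCubicRing (C r), ?_⟩
    beta_reduce
    rw [quotJet_polyToCubicRing, fst_polyJet, eval_C]
  · rw [quotJet_polyToCubicRing, polyJet_X]
  · rw [quotJet_polyToCubicRing, polyJet_X]

end CubicLine

/-- **A nonsingular point that is not `ℝ|ℚ`-regular.** -/
theorem cubic_not_RQ_regular_at_origin :
    (cubicSet = {x | ∃ t : ℝ, x = fun i : Fin 2 =>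
        if i = 0 then (2 : ℝ) ^ ((1 : ℝ) / 3) * t else t}) ∧
    IsNonsingularRAlgebraic 1 cubicSet ∧
    ({q : MvPolynomial (Fin 2) ℚ | ∀ x ∈ cubicSet, aeval x q = 0} =
      (Ideal.span {cubicPoly} : Ideal (MvPolynomial (Fin 2) ℚ))) ∧
    ¬ IsDomain (Localization.AtPrime originIdeal ⧸
        Ideal.span {algebraMap (MvPolynomial (Fin 2) ℝ)
          (Localization.AtPrime originIdeal) cubicPolyR}) ∧
    ¬ IsRegularLocal (Localization.AtPrime originIdeal ⧸
        Ideal.span {algebraMap (MvPolynomial (Fin 2) ℝ)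
          (Localization.AtPrime originIdeal) cubicPolyR}) := by
  refine ⟨CubicLine.cubicSet_eq_line, CubicLine.isNonsingularRAlgebraic_cubicSet, ?_,
    CubicLine.not_isDomain_cubic, CubicLine.not_isRegularLocal_cubic⟩
  ext q
  exact CubicLine.vanishing_iff_mem_span q
end

section
/- ℚ-niceness of the union of a ℚ-nonsingular set and a ℚ-nonsingular hypersurface: Let M ⊆ ℝ^n be a compact C∞ submanifold of dimension d, let X ⊆ M be a ℚ-nonsingular ℚ-algebraic subset of ℝ^n of dimension d − c, and let Y ⊆ M be a ℚ-nonsingular ℚ-algebraic subset of ℝ^n of dimension d − 1. Assume the germ of M at X ∪ Y is the germ of a ℚ-nonsingular ℚ-algebraic set, i.e. there exist an open neighborhood U of X ∪ Y in ℝ^n and a d-dimensional ℚ-nonsingular ℚ-algebraic set V ⊆ ℝ^n with M ∩ U = V ∩ U. Then X ∪ Y is a ℚ-nice ℚ-algebraic set. -/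
open MvPolynomial

open Set Topology
open scoped ContDiff

theorem contDiffOn_parametric_integral_nat {H : Type} [NormedAddCommGroup H] [NormedSpace ℝ H]
    [FiniteDimensional ℝ H] {s : Set H} (hs : IsOpen s) {Ω : Set (H × ℝ)} (hΩ : IsOpen Ω)
    (hsΩ : s ×ˢ Icc (0 : ℝ) 1 ⊆ Ω) (n : ℕ) :
    ∀ {F : Type} [NormedAddCommGroup F] [NormedSpace ℝ F] [CompleteSpace F] {G : H × ℝ → F},
      ContDiffOn ℝ (⊤ : ℕ∞) G Ω → ContDiffOn ℝ n (fun x => ∫ t in (0 : ℝ)..1, G (x, t)) s := by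
  have key : ∀ {F : Type} [NormedAddCommGroup F] [NormedSpace ℝ F] [CompleteSpace F]
      {G : H × ℝ → F}, ContDiffOn ℝ (⊤ : ℕ∞) G Ω → ∀ x₀ ∈ s,
      HasFDerivAt (fun x => ∫ t in (0 : ℝ)..1, G (x, t))
        (∫ t in (0 : ℝ)..1, (fderiv ℝ G (x₀, t)).comp (ContinuousLinearMap.inl ℝ H ℝ)) x₀ := by
    intro F _ _ _ G hG x₀ hx₀
    obtain ⟨δ, hδ, hball⟩ := Metric.isOpen_iff.1 hs x₀ hx₀
    have hIoc : uIoc (0 : ℝ) 1 ⊆ Icc 0 1 := by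
      rw [uIoc_of_le zero_le_one]; exact Ioc_subset_Icc_self
    have hK : Metric.closedBall x₀ (δ / 2) ×ˢ Icc (0 : ℝ) 1 ⊆ Ω :=
      (prod_mono ((Metric.closedBall_subset_ball (by linarith)).trans hball) subset_rfl).trans hsΩ
    have hD : ContinuousOn (fun z => (fderiv ℝ G z).comp (ContinuousLinearMap.inl ℝ H ℝ)) Ω := by
      have := hG.continuousOn_fderiv_of_isOpen hΩ (by simp)
      fun_prop
    have hcont : ∀ {E : Type} [NormedAddCommGroup E] {f : H × ℝ → E}, ContinuousOn f Ω →
        ∀ x ∈ s, ContinuousOn (fun t => f (x, t)) (Icc (0 : ℝ) 1) := fun hf x hx =>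
      hf.comp (by fun_prop) fun t ht => hsΩ ⟨hx, ht⟩
    have hcont' : ∀ {E : Type} [NormedAddCommGroup E] {f : H × ℝ → E}, ContinuousOn f Ω →
        ∀ x ∈ s, MeasureTheory.AEStronglyMeasurable (fun t => f (x, t))
          (MeasureTheory.volume.restrict (uIoc (0 : ℝ) 1)) := fun hf x hx =>
      ((hcont hf x hx).mono hIoc).aestronglyMeasurable measurableSet_uIoc
    obtain ⟨C, hC⟩ := ((isCompact_closedBall x₀ (δ / 2)).prod isCompact_Icc).exists_bound_of_continuousOn
      (hD.mono hK)
    refine intervalIntegral.hasFDerivAt_integral_of_dominated_of_fderiv_le (bound := fun _ => C)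
      (F' := fun x t => (fderiv ℝ G (x, t)).comp (ContinuousLinearMap.inl ℝ H ℝ))
      (Metric.ball_mem_nhds x₀ (half_pos hδ)) ?_ ?_ ?_ ?_ ?_ ?_
    · filter_upwards [hs.mem_nhds hx₀] with x hx using hcont' hG.continuousOn x hx
    · exact ((hcont hG.continuousOn x₀ hx₀).mono (by rw [uIcc_of_le zero_le_one])).intervalIntegrable
    · exact hcont' hD x₀ hx₀
    · exact .of_forall fun t ht x hx => hC (x, t) ⟨Metric.ball_subset_closedBall hx, hIoc ht⟩
    · exact intervalIntegrable_const
    · refine .of_forall fun t ht x hx => ?_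
      have hz : (x, t) ∈ Ω := hK ⟨Metric.ball_subset_closedBall hx, hIoc ht⟩
      have h1 := ((hG.contDiffAt (hΩ.mem_nhds hz)).differentiableAt (by simp)).hasFDerivAt
      exact h1.comp x (hasFDerivAt_prodMk_left x t)
  induction n with
  | zero =>
    intro F _ _ _ G hG
    exact contDiffOn_zero.2 fun x hx => (key hG x hx).continuousAt.continuousWithinAt
  | succ n ih =>
    intro F _ _ _ G hG
    push_cast
    rw [contDiffOn_succ_iff_fderiv_of_isOpen hs]
    refine ⟨fun x hx => (key hG x hx).differentiableAt.differentiableWithinAt, by simp, ?_⟩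
    have h2 : ContDiffOn ℝ (⊤ : ℕ∞)
        (fun z => (fderiv ℝ G z).comp (ContinuousLinearMap.inl ℝ H ℝ)) Ω :=
      (hG.fderiv_of_isOpen hΩ (by simp)).clm_comp contDiffOn_const
    exact (ih h2).congr fun x hx => (key hG x hx).fderiv

theorem contDiffOn_parametric_integral {H : Type} [NormedAddCommGroup H] [NormedSpace ℝ H]
    [FiniteDimensional ℝ H] {s : Set H} (hs : IsOpen s) {Ω : Set (H × ℝ)} (hΩ : IsOpen Ω)
    (hsΩ : s ×ˢ Icc (0 : ℝ) 1 ⊆ Ω) {F : Type} [NormedAddCommGroup F] [NormedSpace ℝ F]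
    [CompleteSpace F] {G : H × ℝ → F} (hG : ContDiffOn ℝ (⊤ : ℕ∞) G Ω) :
    ContDiffOn ℝ (⊤ : ℕ∞) (fun x => ∫ t in (0 : ℝ)..1, G (x, t)) s :=
  contDiffOn_infty.2 fun n => contDiffOn_parametric_integral_nat hs hΩ hsΩ n hG

/-- Hadamard's lemma with parameters. -/
theorem exists_eq_sum_mul_of_eq_zero_on_ball {r : ℕ} {K : Type} [NormedAddCommGroup K]
    [NormedSpace ℝ K] [FiniteDimensional ℝ K] {ε : ℝ} (k₀ : K)
    {g : (Fin r → ℝ) × K → ℝ}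
    (hg : ContDiffOn ℝ (⊤ : ℕ∞) g (Metric.ball 0 ε ×ˢ Metric.ball k₀ ε))
    (h0 : ∀ k ∈ Metric.ball k₀ ε, g (0, k) = 0) :
    ∃ u : Fin r → (Fin r → ℝ) × K → ℝ,
      (∀ j, ContDiffOn ℝ (⊤ : ℕ∞) (u j) (Metric.ball 0 ε ×ˢ Metric.ball k₀ ε)) ∧
      ∀ z ∈ Metric.ball (0 : Fin r → ℝ) ε ×ˢ Metric.ball k₀ ε, g z = ∑ j, u j z * z.1 j := by
  set B : Set ((Fin r → ℝ) × K) := Metric.ball 0 ε ×ˢ Metric.ball k₀ ε with hB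
  have hBo : IsOpen B := Metric.isOpen_ball.prod Metric.isOpen_ball
  let σ : ((Fin r → ℝ) × K) × ℝ → (Fin r → ℝ) × K := fun w => (w.2 • w.1.1, w.1.2)
  have hσ : ContDiff ℝ (⊤ : ℕ∞) σ := by fun_prop
  have hmem : ∀ z ∈ B, ∀ t ∈ Icc (0 : ℝ) 1, σ (z, t) ∈ B := by
    rintro ⟨y, k⟩ ⟨hy, hk⟩ t ⟨ht0, ht1⟩
    refine ⟨?_, hk⟩
    simp only [σ, mem_ball_zero_iff, norm_smul, Real.norm_eq_abs, abs_of_nonneg ht0] at hy ⊢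
    nlinarith [norm_nonneg y]
  have hdg := hg.fderiv_of_isOpen hBo (m := (⊤ : ℕ∞)) (by simp)
  have hD := contDiffOn_parametric_integral hBo (hBo.preimage hσ.continuous)
    (fun w hw => hmem w.1 hw.1 w.2 hw.2) (hdg.comp hσ.contDiffOn fun _ h => h)
  set D := fun z => ∫ t in (0 : ℝ)..1, (fderiv ℝ g ∘ σ) (z, t)
  refine ⟨fun j z => D z (Pi.single j 1, 0), fun j => hD.clm_apply contDiffOn_const, ?_⟩
  intro z hz
  have hsum : ((z.1, 0) : (Fin r → ℝ) × K) = ∑ j, z.1 j • (Pi.single j 1, 0) := by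
    ext i
    · simp [Prod.fst_sum, Finset.sum_apply, Pi.single_apply]
    · simp [Prod.snd_sum]
  have hc : ContinuousOn (fun t => (fderiv ℝ g ∘ σ) (z, t)) (uIcc (0 : ℝ) 1) := by
    rw [uIcc_of_le zero_le_one]
    exact hdg.continuousOn.comp (f := fun t => σ (z, t)) (by fun_prop) fun t ht => hmem z hz t ht
  have hFTC : ∫ t in (0 : ℝ)..1, (fderiv ℝ g ∘ σ) (z, t) (z.1, 0) = g (σ (z, 1)) - g (σ (z, 0)) := by
    refine intervalIntegral.integral_eq_sub_of_hasDerivAt (f := fun t => g (σ (z, t))) ?_ ?_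
    · intro t ht
      rw [uIcc_of_le zero_le_one] at ht
      have h1 := ((hg.contDiffAt (hBo.mem_nhds (hmem z hz t ht))).differentiableAt
        (by simp)).hasFDerivAt
      have h2 : HasDerivAt (fun t : ℝ => σ (z, t)) (z.1, 0) t := by
        have := ((hasDerivAt_id t).smul_const z.1).prodMk (hasDerivAt_const t z.2)
        simpa [σ] using this
      exact h1.comp_hasDerivAt t h2
    · exact (hc.clm_apply continuousOn_const).intervalIntegrable
  have h1 : σ (z, 1) = z := by simp [σ]
  have h2 : g (σ (z, 0)) = 0 := by simpa [σ] using h0 z.2 hz.2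
  rw [h1, h2, sub_zero] at hFTC
  rw [← hFTC, ← ContinuousLinearMap.intervalIntegral_apply hc.intervalIntegrable, hsum, map_sum]
  refine Finset.sum_congr rfl fun j _ => ?_
  rw [map_smul, smul_eq_mul, mul_comm]

theorem surjective_pi_of_linearIndependent {E : Type} [NormedAddCommGroup E] [NormedSpace ℝ E]
    {r : ℕ} {φ : Fin r → E →L[ℝ] ℝ} (h : LinearIndependent ℝ φ) :
    Function.Surjective (ContinuousLinearMap.pi φ) := by
  by_contra hns
  have hlt : (ContinuousLinearMap.pi φ).toLinearMap.range < ⊤ :=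
    lt_top_iff_ne_top.2 fun htop => hns (LinearMap.range_eq_top.1 htop)
  obtain ⟨f, hf, hle⟩ := Submodule.exists_le_ker_of_lt_top _ hlt
  have hf' : ∀ v : Fin r → ℝ, f v = ∑ j, f (Pi.single j 1) * v j := fun v => by
    conv_lhs => rw [← Finset.univ_sum_single v, map_sum]
    refine Finset.sum_congr rfl fun j _ => ?_
    have : (Pi.single j (v j) : Fin r → ℝ) = v j • Pi.single j 1 := by
      rw [← Pi.single_smul, smul_eq_mul, mul_one]
    rw [this, map_smul, smul_eq_mul, mul_comm]
  have h0 : ∀ j, f (Pi.single j 1) = 0 := by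
    refine Fintype.linearIndependent_iff.1 h _ (ContinuousLinearMap.ext fun x => ?_)
    have : f (ContinuousLinearMap.pi φ x) = 0 := hle ⟨x, rfl⟩
    rw [hf'] at this
    simpa using this
  exact hf (LinearMap.ext fun v => by rw [hf']; simp [h0])

/-- Analytic functions with independent differentials extend to an analytic chart. -/
theorem exists_chart_of_linearIndependent {E : Type} [NormedAddCommGroup E] [NormedSpace ℝ E]
    [FiniteDimensional ℝ E] {r : ℕ} {q : Fin r → E → ℝ} {a : E}
    (hq : ∀ j, ContDiff ℝ ω (q j)) (hli : LinearIndependent ℝ fun j => fderiv ℝ (q j) a) :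
    ∃ (K : Submodule ℝ E) (e : OpenPartialHomeomorph E ((Fin r → ℝ) × K)),
      a ∈ e.source ∧ ContDiff ℝ ω e ∧ ContDiffAt ℝ ω e.symm (e a) ∧
      ∀ x, (e x).1 = fun j => q j x := by
  have : CompleteSpace E := FiniteDimensional.complete ℝ E
  set T := ContinuousLinearMap.pi fun j => fderiv ℝ (q j) a with hT
  have hsurj : Function.Surjective T := surjective_pi_of_linearIndependent hli
  set K := T.toLinearMap.ker
  obtain ⟨L, hL⟩ : K.ClosedComplemented := Submodule.ClosedComplemented.of_finiteDimensional K
  have hbij : Function.Bijective (T.prod L) := by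
    constructor
    · rw [injective_iff_map_eq_zero]
      intro x hx
      have hx1 : T x = 0 := congrArg Prod.fst hx
      have hx2 : L x = 0 := congrArg Prod.snd hx
      have := hL ⟨x, hx1⟩
      rw [hx2] at this
      exact (congrArg Subtype.val this).symm
    · rintro ⟨y, k⟩
      obtain ⟨x, rfl⟩ := hsurj y
      refine ⟨x + ((k - L x : K) : E), Prod.ext ?_ ?_⟩
      · have : T ((k - L x : K) : E) = 0 := (k - L x).2
        change T (x + _) = _
        rw [map_add, this, add_zero]
      · change L (x + _) = _
        rw [map_add, hL]; abel
  let Φ' := ContinuousLinearEquiv.ofBijective (T.prod L) (LinearMap.ker_eq_bot.2 hbij.1)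
    (LinearMap.range_eq_top.2 hbij.2)
  let Φ : E → (Fin r → ℝ) × K := fun x => (fun j => q j x, L x)
  have hΦ : ContDiff ℝ ω Φ := (contDiff_pi.2 hq).prodMk L.contDiff
  have hΦ' : HasFDerivAt Φ (Φ' : E →L[ℝ] (Fin r → ℝ) × K) a := by
    refine HasFDerivAt.prodMk ?_ L.hasFDerivAt
    exact hasFDerivAt_pi.2 fun j => ((hq j).differentiable (by simp) a).hasFDerivAt
  have ha := hΦ.contDiffAt.mem_toOpenPartialHomeomorph_source hΦ' (by simp)
  refine ⟨K, hΦ.contDiffAt.toOpenPartialHomeomorph Φ hΦ' (by simp), ha, hΦ, ?_, fun x => rfl⟩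
  refine OpenPartialHomeomorph.contDiffAt_symm _ (OpenPartialHomeomorph.map_source _ ha) (f₀' := Φ')
    ?_ ?_
  · rw [OpenPartialHomeomorph.left_inv _ ha]; exact hΦ'
  · exact hΦ.contDiffAt

/-- A chart adapted to `q`, whose image is a product of balls and whose source is small. -/
theorem exists_ball_chart {E : Type} [NormedAddCommGroup E] [NormedSpace ℝ E]
    [FiniteDimensional ℝ E] {r : ℕ} {q : Fin r → E → ℝ} {a : E}
    (hq : ∀ j, ContDiff ℝ ω (q j)) (hqa : ∀ j, q j a = 0)
    (hli : LinearIndependent ℝ fun j => fderiv ℝ (q j) a) {W : Set E} (hW : W ∈ 𝓝 a) :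
    ∃ (K : Submodule ℝ E) (k₀ : K) (ε : ℝ) (U : Set E) (p : E → K)
      (ψ : (Fin r → ℝ) × K → E),
      0 < ε ∧ IsOpen U ∧ a ∈ U ∧ U ⊆ W ∧ ContDiff ℝ ω p ∧
      AnalyticOnNhd ℝ ψ (Metric.ball 0 ε ×ˢ Metric.ball k₀ ε) ∧
      MapsTo ψ (Metric.ball 0 ε ×ˢ Metric.ball k₀ ε) U ∧
      (∀ x ∈ U, ((fun j => q j x, p x) : (Fin r → ℝ) × K) ∈
        Metric.ball 0 ε ×ˢ Metric.ball k₀ ε) ∧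
      (∀ x ∈ U, ψ (fun j => q j x, p x) = x) ∧
      ∀ z ∈ Metric.ball 0 ε ×ˢ Metric.ball k₀ ε, ∀ j, q j (ψ z) = z.1 j := by
  obtain ⟨K, e, ha, he, hes, he1⟩ := exists_chart_of_linearIndependent hq hli
  have hea : e a = (0, (e a).2) := Prod.ext (by rw [he1]; ext j; exact hqa j) rfl
  have h1 : ∀ᶠ z in 𝓝 (e a), ContDiffAt ℝ ω e.symm z := hes.eventually (by simp)
  have h2 : ∀ᶠ z in 𝓝 (e a), z ∈ e.target := e.open_target.mem_nhds (e.map_source ha)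
  have h3 : ∀ᶠ z in 𝓝 (e a), e.symm z ∈ W := by
    refine hes.continuousAt.eventually_mem ?_
    rwa [e.left_inv ha]
  obtain ⟨ε, hε, hball⟩ := Metric.eventually_nhds_iff_ball.1 (h1.and (h2.and h3))
  rw [hea, ← ball_prod_same] at hball
  have hex : ∀ x, e x = (fun j => q j x, (e x).2) := fun x => Prod.ext (he1 x) rfl
  refine ⟨K, (e a).2, ε, e.source ∩ e ⁻¹' (Metric.ball 0 ε ×ˢ Metric.ball (e a).2 ε),
    fun x => (e x).2, e.symm, hε,
    e.isOpen_inter_preimage (Metric.isOpen_ball.prod Metric.isOpen_ball),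
    ⟨ha, ?_⟩, ?_, contDiff_snd.comp he, ?_, ?_, ?_, ?_, ?_⟩
  · rw [mem_preimage, hea]; exact ⟨Metric.mem_ball_self hε, Metric.mem_ball_self hε⟩
  · rintro x ⟨hxs, hx⟩
    have := (hball _ hx).2.2
    rwa [e.left_inv hxs] at this
  · exact fun z hz => (hball z hz).1.analyticAt
  · intro z hz
    have ht := (hball z hz).2.1
    refine ⟨e.map_target ht, ?_⟩
    rwa [mem_preimage, e.right_inv ht]
  · rintro x ⟨hxs, hx⟩
    rw [← hex]; exact hx
  · rintro x ⟨hxs, hx⟩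
    rw [← hex]; exact e.left_inv hxs
  · intro z hz j
    have := he1 (e.symm z)
    rw [e.right_inv (hball z hz).2.1] at this
    exact (congrFun this j).symm

/-- Near `a`, every smooth function vanishing on `Z` is a combination of the `w j` with smooth
coefficients, on arbitrarily small neighborhoods of `a`. -/
def LocallyGenerates {E : Type} [NormedAddCommGroup E] [NormedSpace ℝ E] {r : ℕ} (Z : Set E)
    (a : E) (w : Fin r → E → ℝ) : Prop :=
  ∀ W ∈ 𝓝 a, ∃ U ⊆ W, IsOpen U ∧ a ∈ U ∧ ∀ f : E → ℝ, ContDiffOn ℝ (⊤ : ℕ∞) f U →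
    (∀ x ∈ U, x ∈ Z → f x = 0) → ∃ u : Fin r → E → ℝ,
      (∀ j, ContDiffOn ℝ (⊤ : ℕ∞) (u j) U) ∧ ∀ x ∈ U, f x = ∑ j, u j x * w j x

theorem LocallyGenerates.congr_set {E : Type} [NormedAddCommGroup E] [NormedSpace ℝ E] {r : ℕ}
    {Z Z' : Set E} {a : E} {w : Fin r → E → ℝ} (h : LocallyGenerates Z a w)
    (hZ : ∀ᶠ x in 𝓝 a, x ∈ Z → x ∈ Z') : LocallyGenerates Z' a w := by
  intro W hW
  obtain ⟨U, hUW, hU, haU, H⟩ := h _ (Filter.inter_mem hW hZ)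
  exact ⟨U, fun x hx => (hUW hx).1, hU, haU, fun f hf h0 =>
    H f hf fun x hx hxZ => h0 x hx ((hUW hx).2 hxZ)⟩

theorem locallyGenerates_zeroSet {E : Type} [NormedAddCommGroup E] [NormedSpace ℝ E]
    [FiniteDimensional ℝ E] {r : ℕ} {q : Fin r → E → ℝ} {a : E}
    (hq : ∀ j, ContDiff ℝ ω (q j)) (hqa : ∀ j, q j a = 0)
    (hli : LinearIndependent ℝ fun j => fderiv ℝ (q j) a) :
    LocallyGenerates {x | ∀ j, q j x = 0} a q := by
  intro W hW
  obtain ⟨K, k₀, ε, U, p, ψ, hε, hU, haU, hUW, hp, hψ, hψU, hUB, hl, hr⟩ :=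
    exists_ball_chart hq hqa hli hW
  refine ⟨U, hUW, hU, haU, fun f hf h0 => ?_⟩
  obtain ⟨u, hu, hfu⟩ := exists_eq_sum_mul_of_eq_zero_on_ball k₀
    (hf.comp (hψ.contDiffOn (Metric.isOpen_ball.prod Metric.isOpen_ball).uniqueDiffOn) hψU) (by
      intro k hk
      have hz : ((0, k) : (Fin r → ℝ) × K) ∈ Metric.ball 0 ε ×ˢ Metric.ball k₀ ε :=
        ⟨Metric.mem_ball_self hε, hk⟩
      exact h0 _ (hψU hz) fun j => hr _ hz j)
  have hch : ContDiff ℝ (⊤ : ℕ∞) fun x => ((fun j => q j x, p x) : (Fin r → ℝ) × K) :=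
    ((contDiff_pi.2 hq).prodMk hp).of_le le_top
  refine ⟨fun j x => u j (fun j => q j x, p x), fun j => (hu j).comp hch.contDiffOn hUB, ?_⟩
  intro x hx
  have := hfu _ (hUB x hx)
  rwa [Function.comp_apply, hl x hx] at this

/-- An analytic function either vanishes on a regular zero set near `a`, or its nonzero locus
is dense in it near `a`. -/
theorem eventually_eq_zero_or_mem_closure {E : Type} [NormedAddCommGroup E] [NormedSpace ℝ E]
    [FiniteDimensional ℝ E] {r : ℕ} {q : Fin r → E → ℝ} {a : E}
    (hq : ∀ j, ContDiff ℝ ω (q j)) (hqa : ∀ j, q j a = 0)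
    (hli : LinearIndependent ℝ fun j => fderiv ℝ (q j) a) {y : E → ℝ} (hy : ContDiff ℝ ω y) :
    (∀ᶠ x in 𝓝 a, (∀ j, q j x = 0) → y x = 0) ∨
      ∀ᶠ x in 𝓝 a, (∀ j, q j x = 0) → x ∈ closure {z | (∀ j, q j z = 0) ∧ y z ≠ 0} := by
  obtain ⟨K, k₀, ε, U, p, ψ, hε, hU, haU, -, hp, hψ, hψU, hUB, hl, hr⟩ :=
    exists_ball_chart hq hqa hli Filter.univ_mem
  have hz : ∀ k ∈ Metric.ball k₀ ε,
      ((0, k) : (Fin r → ℝ) × K) ∈ Metric.ball 0 ε ×ˢ Metric.ball k₀ ε :=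
    fun k hk => ⟨Metric.mem_ball_self hε, hk⟩
  have hψ0 : AnalyticOnNhd ℝ (fun k : K => ψ (0, k)) (Metric.ball k₀ ε) :=
    fun k hk => (hψ _ (hz k hk)).fun_comp (by fun_prop)
  have hφ : AnalyticOnNhd ℝ (fun k : K => y (ψ (0, k))) (Metric.ball k₀ ε) :=
    fun k hk => (hy.contDiffAt.analyticAt).fun_comp (hψ0 k hk)
  have hx : ∀ x ∈ U, (∀ j, q j x = 0) → p x ∈ Metric.ball k₀ ε ∧ ψ (0, p x) = x := by
    intro x hx h0
    have h0' : (fun j => q j x) = 0 := funext h0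
    have h1 := hUB x hx
    have h2 := hl x hx
    rw [h0'] at h1 h2
    exact ⟨h1.2, h2⟩
  by_cases h : ∃ k ∈ Metric.ball k₀ ε, ∀ᶠ k' in 𝓝 k, y (ψ (0, k')) = 0
  · left
    obtain ⟨k, hk, h⟩ := h
    have := hφ.eqOn_zero_of_preconnected_of_eventuallyEq_zero
      (convex_ball k₀ ε).isPreconnected hk h
    filter_upwards [hU.mem_nhds haU] with x hxU h0
    obtain ⟨h1, h2⟩ := hx x hxU h0
    simpa [h2] using this h1
  · right
    push Not at h
    filter_upwards [hU.mem_nhds haU] with x hxU h0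
    obtain ⟨h1, h2⟩ := hx x hxU h0
    rw [mem_closure_iff_frequently]
    have ht : Filter.Tendsto (fun k => ψ (0, k)) (𝓝 (p x)) (𝓝 x) := by
      simpa only [ContinuousAt, h2] using (hψ0 _ h1).continuousAt
    refine ht.frequently (((h _ h1).and_eventually (Metric.isOpen_ball.mem_nhds h1)).mono ?_)
    exact fun k hk => ⟨fun j => hr _ (hz k hk.2) j, hk.1⟩

/-- Functions vanishing on a regular zero set, equal in number to its equations and with
independent differentials, generate its ideal. -/
theorem LocallyGenerates.of_linearIndependent {E : Type} [NormedAddCommGroup E] [NormedSpace ℝ E]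
    {r : ℕ} {Z : Set E} {q w : Fin r → E → ℝ} {a : E}
    (hZ : LocallyGenerates Z a q) (hq : ∀ j, DifferentiableAt ℝ (q j) a) (hqa : ∀ j, q j a = 0)
    (hw : ∀ j, ContDiff ℝ (⊤ : ℕ∞) (w j)) (hwZ : ∀ j, ∀ x ∈ Z, w j x = 0)
    (hli : LinearIndependent ℝ fun j => fderiv ℝ (w j) a) :
    LocallyGenerates Z a w := by
  intro W hW
  obtain ⟨U₀, hU₀W, hU₀, haU₀, H₀⟩ := hZ W hW
  choose A hA hwA using fun i => H₀ (w i) (hw i).contDiffOn fun x _ hx => hwZ i x hx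
  let M : E → Matrix (Fin r) (Fin r) ℝ := fun x => Matrix.of fun i j => A i j x
  have hM : ∀ (B : E → Matrix (Fin r) (Fin r) ℝ) (U : Set E),
      (∀ i j, ContDiffOn ℝ (⊤ : ℕ∞) (fun x => B x i j) U) →
      ContDiffOn ℝ (⊤ : ℕ∞) (fun x => (B x).det) U := by
    intro B U hB
    simp only [Matrix.det_apply']
    exact ContDiffOn.sum fun σ _ => contDiffOn_const.mul (contDiffOn_prod fun i _ => hB _ _)
  have hdet := hM M U₀ fun i j => hA i j
  have hadj : ∀ i j, ContDiffOn ℝ (⊤ : ℕ∞) (fun x => (M x).adjugate i j) U₀ := by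
    intro i j
    simp only [Matrix.adjugate_apply]
    refine hM _ _ fun k l => ?_
    by_cases hk : k = j
    · subst hk; simpa using contDiffOn_const
    · simp only [Matrix.updateRow_ne hk]; exact hA k l
  have hdet0 : (M a).det ≠ 0 := by
    intro h0
    obtain ⟨v, hv, hv0⟩ := Matrix.exists_vecMul_eq_zero_iff.2 h0
    refine hv (funext (Fintype.linearIndependent_iff.1 hli v ?_))
    have hd : ∀ i, fderiv ℝ (w i) a = ∑ j, A i j a • fderiv ℝ (q j) a := by
      intro i
      have h1 : w i =ᶠ[𝓝 a] fun x => ∑ j, A i j x * q j x :=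
        Filter.eventuallyEq_of_mem (hU₀.mem_nhds haU₀) (hwA i)
      have h2 : HasFDerivAt (fun x => ∑ j, A i j x * q j x)
          (∑ j, A i j a • fderiv ℝ (q j) a) a := by
        refine HasFDerivAt.fun_sum fun j _ => ?_
        have h3 := (((hA i j).contDiffAt (hU₀.mem_nhds haU₀)).differentiableAt
          (by simp)).hasFDerivAt.fun_mul (hq j).hasFDerivAt
        simpa [hqa j] using h3
      rw [h1.fderiv_eq, h2.fderiv]
    simp only [hd, Finset.smul_sum, smul_smul]
    rw [Finset.sum_comm]
    refine Finset.sum_eq_zero fun j _ => ?_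
    rw [← Finset.sum_smul]
    have : ∑ i, v i * A i j a = 0 := congrFun hv0 j
    rw [this, zero_smul]
  have hev : ∀ᶠ x in 𝓝 a, x ∈ U₀ ∧ (M x).det ≠ 0 :=
    (Filter.eventually_of_mem (hU₀.mem_nhds haU₀) fun _ h => h).and
      ((hdet.continuousOn.continuousAt (hU₀.mem_nhds haU₀)).eventually_ne hdet0)
  obtain ⟨U, hUW, hU, haU, H⟩ := hZ _ hev
  refine ⟨U, fun x hx => hU₀W (hUW hx).1, hU, haU, fun f hf hfZ => ?_⟩
  obtain ⟨u, hu, hfu⟩ := H f hf hfZ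
  have hUU₀ : U ⊆ U₀ := fun x hx => (hUW hx).1
  refine ⟨fun k x => (∑ j, u j x * (M x).adjugate j k) / (M x).det, fun k => ?_, fun x hx => ?_⟩
  · exact (ContDiffOn.sum fun j _ => (hu j).mul ((hadj j k).mono hUU₀)).div (hdet.mono hUU₀)
      fun x hx => (hUW hx).2
  · have hMq : (M x).mulVec (fun j => q j x) = fun i => w i x := by
      ext i
      exact (hwA i x (hUU₀ hx)).symm
    have hadjw : (M x).adjugate.mulVec (fun i => w i x) = (M x).det • fun j => q j x := by
      rw [← hMq, Matrix.mulVec_mulVec, Matrix.adjugate_mul, Matrix.smul_mulVec, Matrix.one_mulVec]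
    have hd := (hUW hx).2
    have hqj : ∀ j, q j x = (∑ k, (M x).adjugate j k * w k x) / (M x).det := by
      intro j
      rw [eq_div_iff hd, mul_comm]
      exact (congrFun hadjw j).symm
    rw [hfu x hx]
    calc ∑ j, u j x * q j x = ∑ j, ∑ k, u j x * (M x).adjugate j k * w k x / (M x).det := by
          refine Finset.sum_congr rfl fun j _ => ?_
          rw [hqj, Finset.sum_div, Finset.mul_sum]
          exact Finset.sum_congr rfl fun k _ => by ring
      _ = _ := by
          rw [Finset.sum_comm]
          refine Finset.sum_congr rfl fun k _ => ?_
          simp only [Finset.sum_div, Finset.sum_mul]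
          exact Finset.sum_congr rfl fun j _ => by ring

theorem linearIndependent_proj (n : ℕ) :
    LinearIndependent ℝ fun j : Fin n =>
      (ContinuousLinearMap.proj j : (Fin n → ℝ) →L[ℝ] ℝ) := by
  rw [Fintype.linearIndependent_iff]
  intro c hc i
  have := DFunLike.congr_fun hc (Pi.single i 1)
  simpa [Pi.single_apply] using this

theorem exists_mvPolynomial_isBigO {n : ℕ} (a : Fin n → ℝ) (N : ℕ) :
    ∀ {f : (Fin n → ℝ) → ℝ} {U : Set (Fin n → ℝ)}, U ∈ 𝓝 a → ContDiffOn ℝ (⊤ : ℕ∞) f U →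
      ∃ T : MvPolynomial (Fin n) ℝ,
        (fun x => f x - eval (x - a) T) =O[𝓝 a] fun x => ‖x - a‖ ^ N := by
  induction N with
  | zero =>
    intro f U hU hf
    refine ⟨0, ?_⟩
    simpa using (hf.continuousOn.continuousAt hU).isBigO_one ℝ
  | succ N ih =>
    intro f U hU hf
    have hd : ∀ j, fderiv ℝ (fun x : Fin n → ℝ => x j - a j) a = ContinuousLinearMap.proj j := by
      intro j
      rw [fderiv_sub_const]
      exact (ContinuousLinearMap.proj j : (Fin n → ℝ) →L[ℝ] ℝ).fderiv
    have hgen : LocallyGenerates {x | ∀ j, x j - a j = 0} a fun j (x : Fin n → ℝ) => x j - a j := by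
      refine locallyGenerates_zeroSet (fun j => by fun_prop) (by simp) ?_
      simpa only [hd] using linearIndependent_proj n
    obtain ⟨V, hVU, hV, haV, H⟩ := hgen U hU
    obtain ⟨u, hu, hfu⟩ := H (fun x => f x - f a) ((hf.mono hVU).sub contDiffOn_const) (by
      intro x _ hx
      have : x = a := funext fun j => sub_eq_zero.1 (hx j)
      simp [this])
    choose T hT using fun j => ih (hV.mem_nhds haV) (hu j)
    refine ⟨C (f a) + ∑ j, T j * X j, ?_⟩
    have h1 : (fun x => f x - eval (x - a) (C (f a) + ∑ j, T j * X j)) =ᶠ[𝓝 a]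
        fun x => ∑ j, (u j x - eval (x - a) (T j)) * (x j - a j) := by
      filter_upwards [hV.mem_nhds haV] with x hx
      have := hfu x hx
      simp only [map_add, map_sum, map_mul, eval_C, eval_X, sub_mul, Finset.sum_sub_distrib,
        ← this, Pi.sub_apply]
      ring
    refine h1.trans_isBigO (Asymptotics.IsBigO.fun_sum fun j _ => ?_)
    simp only [pow_succ]
    refine (hT j).mul (Asymptotics.IsBigO.of_bound 1 (.of_forall fun x => ?_))
    rw [one_mul, norm_norm]
    exact norm_le_pi_norm (x - a) j

theorem eval_isBigO_of_mem_pow_idealOfVars {n N : ℕ} {P : MvPolynomial (Fin n) ℝ}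
    (hP : P ∈ idealOfVars (Fin n) ℝ ^ N) :
    (fun x => eval x P) =O[𝓝 0] fun x => ‖x‖ ^ N := by
  simp only [eval_eq]
  refine Asymptotics.IsBigO.fun_sum fun m hm => ?_
  have hdeg := (mem_pow_idealOfVars_iff N P).1 hP m hm
  refine Asymptotics.IsBigO.of_bound ‖coeff m P‖ ?_
  filter_upwards [Metric.ball_mem_nhds (0 : Fin n → ℝ) one_pos] with x hx
  rw [mem_ball_zero_iff] at hx
  rw [norm_mul, norm_pow, norm_norm, norm_prod]
  gcongr
  calc ∏ i ∈ m.support, ‖x i ^ m i‖ ≤ ∏ i ∈ m.support, ‖x‖ ^ m i := by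
        refine Finset.prod_le_prod (fun _ _ => norm_nonneg _) fun i _ => ?_
        rw [norm_pow]
        exact pow_le_pow_left₀ (norm_nonneg _) (norm_le_pi_norm x i) _
    _ = ‖x‖ ^ m.degree := by rw [Finset.prod_pow_eq_pow_sum]; rfl
    _ ≤ ‖x‖ ^ N := pow_le_pow_of_le_one (norm_nonneg _) hx.le hdeg

theorem mem_pow_idealOfVars_of_isBigO {n : ℕ} (N : ℕ) {P : MvPolynomial (Fin n) ℝ}
    (hP : (fun x => eval x P) =O[𝓝 0] fun x => ‖x‖ ^ N) :
    P ∈ idealOfVars (Fin n) ℝ ^ N := by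
  induction N with
  | zero => simp
  | succ N ih =>
    have hN : P ∈ idealOfVars (Fin n) ℝ ^ N := by
      refine ih (hP.trans (Asymptotics.IsBigO.of_bound 1 ?_))
      filter_upwards [Metric.ball_mem_nhds (0 : Fin n → ℝ) one_pos] with x hx
      rw [mem_ball_zero_iff] at hx
      simpa using pow_le_pow_of_le_one (norm_nonneg x) hx.le (Nat.le_succ N)
    rw [mem_pow_idealOfVars_iff'] at hN
    set Q := homogeneousComponent N P with hQ
    have hrest : P - Q ∈ idealOfVars (Fin n) ℝ ^ (N + 1) := by
      rw [mem_pow_idealOfVars_iff']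
      intro m hm
      rw [coeff_sub, hQ, coeff_homogeneousComponent]
      split_ifs with h
      · simp
      · rw [hN m (by omega), sub_zero]
    have hQO : (fun x => eval x Q) =O[𝓝 0] fun x => ‖x‖ ^ (N + 1) := by
      simpa using hP.sub (eval_isBigO_of_mem_pow_idealOfVars hrest)
    have hQ0 : Q = 0 := by
      refine MvPolynomial.funext fun v => ?_
      rw [map_zero]
      obtain ⟨c, hc⟩ := hQO.bound
      have ht : Filter.Tendsto (fun t : ℝ => t • v) (𝓝[>] 0) (𝓝 0) := by
        have : Filter.Tendsto (fun t : ℝ => t • v) (𝓝 0) (𝓝 ((0 : ℝ) • v)) :=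
          Continuous.tendsto (by fun_prop) 0
        rw [zero_smul] at this
        exact this.mono_left nhdsWithin_le_nhds
      have hle : ∀ᶠ t : ℝ in 𝓝[>] 0, ‖eval v Q‖ ≤ c * (t * ‖v‖ ^ (N + 1)) := by
        filter_upwards [ht.eventually hc, self_mem_nhdsWithin] with t htc (ht0 : 0 < t)
        have hhom : eval (t • v) Q = t ^ N * eval v Q := by
          rw [eval_eq, eval_eq, Finset.mul_sum]
          refine Finset.sum_congr rfl fun m hm => ?_
          have hdeg : m.degree = N := by
            by_contra hne
            exact mem_support_iff.1 hm
              ((homogeneousComponent_isHomogeneous N P).coeff_eq_zero hne)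
          have hpow : ∏ i ∈ m.support, t ^ m i = t ^ N := by
            rw [Finset.prod_pow_eq_pow_sum, ← hdeg]; rfl
          simp only [Pi.smul_apply, smul_eq_mul, mul_pow, Finset.prod_mul_distrib, hpow]
          ring
        rw [hhom, norm_mul, norm_pow, norm_pow, norm_norm, norm_smul, Real.norm_of_nonneg ht0.le,
          mul_pow] at htc
        have : t ^ N * ‖eval v Q‖ ≤ t ^ N * (c * (t * ‖v‖ ^ (N + 1))) := by
          rw [pow_succ t] at htc; linarith
        exact le_of_mul_le_mul_left this (pow_pos ht0 N)
      have hlim : Filter.Tendsto (fun t : ℝ => c * (t * ‖v‖ ^ (N + 1))) (𝓝[>] 0) (𝓝 0) := by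
        have : Filter.Tendsto (fun t : ℝ => c * (t * ‖v‖ ^ (N + 1))) (𝓝 0)
            (𝓝 (c * (0 * ‖v‖ ^ (N + 1)))) := Continuous.tendsto (by fun_prop) 0
        rw [zero_mul, mul_zero] at this
        exact this.mono_left nhdsWithin_le_nhds
      exact norm_le_zero_iff.1 (ge_of_tendsto hlim hle)
    rw [hQ0, sub_zero] at hrest
    exact hrest

/-- Coefficientwise application of a `ℚ`-linear functional on `ℝ`. -/
noncomputable def mapCoeffQ {σ : Type*} (l : ℝ →ₗ[ℚ] ℚ) (s : MvPolynomial σ ℝ) : MvPolynomial σ ℚ :=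
  ∑ m ∈ s.support, monomial m (l (coeff m s))

theorem coeff_mapCoeffQ {σ : Type*} (l : ℝ →ₗ[ℚ] ℚ) (s : MvPolynomial σ ℝ) (m : σ →₀ ℕ) :
    coeff m (mapCoeffQ l s) = l (coeff m s) := by
  classical
  simp only [mapCoeffQ, coeff_sum, coeff_monomial, Finset.sum_ite_eq', mem_support_iff]
  split_ifs with h
  · rfl
  · simp [not_not.1 h]

theorem mapCoeffQ_mul_map {σ : Type*} (l : ℝ →ₗ[ℚ] ℚ) (s : MvPolynomial σ ℝ)
    (p : MvPolynomial σ ℚ) :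
    mapCoeffQ l (s * MvPolynomial.map (algebraMap ℚ ℝ) p) = mapCoeffQ l s * p := by
  classical
  ext m
  rw [coeff_mapCoeffQ, coeff_mul, coeff_mul, map_sum]
  refine Finset.sum_congr rfl fun x _ => ?_
  rw [coeff_map, coeff_mapCoeffQ, mul_comm, ← Algebra.smul_def, map_smul, smul_eq_mul, mul_comm]

theorem mapCoeffQ_sum {σ κ : Type*} (l : ℝ →ₗ[ℚ] ℚ) (t : Finset κ)
    (s : κ → MvPolynomial σ ℝ) :
    mapCoeffQ l (∑ i ∈ t, s i) = ∑ i ∈ t, mapCoeffQ l (s i) := by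
  ext m
  simp only [coeff_mapCoeffQ, coeff_sum, map_sum]

theorem exists_aeval_mapCoeffQ_ne_zero {n : ℕ} {s : MvPolynomial (Fin n) ℝ} {a : Fin n → ℝ}
    (h : eval a s ≠ 0) : ∃ l : ℝ →ₗ[ℚ] ℚ, aeval a (mapCoeffQ l s) ≠ 0 := by
  by_contra! hcon
  let b := Module.Basis.ofVectorSpace ℚ ℝ
  let t := s.support.biUnion fun m => (b.repr (coeff m s)).support
  have hcoeff : ∀ m ∈ s.support, coeff m s = ∑ i ∈ t, (b.coord i (coeff m s) : ℝ) * b i := by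
    intro m hm
    conv_lhs => rw [← b.linearCombination_repr (coeff m s), Finsupp.linearCombination_apply]
    rw [Finsupp.sum_of_support_subset (s := t) _
      (Finset.subset_biUnion_of_mem (fun m => (b.repr (coeff m s)).support) hm) _ (by simp)]
    exact Finset.sum_congr rfl fun i _ => by simp [Algebra.smul_def]
  refine h ?_
  have hval : ∀ l : ℝ →ₗ[ℚ] ℚ, aeval a (mapCoeffQ l s) =
      ∑ m ∈ s.support, (l (coeff m s) : ℝ) * ∏ i ∈ m.support, a i ^ m i := by
    intro l
    simp [mapCoeffQ, map_sum, aeval_monomial, Finsupp.prod]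
  calc eval a s = ∑ m ∈ s.support, ∑ i ∈ t, (b.coord i (coeff m s) : ℝ) * b i *
        ∏ k ∈ m.support, a k ^ m k := by
        rw [eval_eq]
        refine Finset.sum_congr rfl fun m hm => ?_
        conv_lhs => rw [hcoeff m hm]
        rw [Finset.sum_mul]
    _ = ∑ i ∈ t, b i * aeval a (mapCoeffQ (b.coord i) s) := by
        rw [Finset.sum_comm]
        refine Finset.sum_congr rfl fun i _ => ?_
        rw [hval, Finset.mul_sum]
        exact Finset.sum_congr rfl fun m _ => by ring
    _ = 0 := by simp [hcon]

/-- A rational polynomial that is a combination of rational polynomials `q j` with smooth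
coefficients near `a` is one with polynomial coefficients, up to a factor nonzero at `a`. -/
theorem exists_mul_mem_span_of_smooth_combination {n r : ℕ} {a : Fin n → ℝ}
    {p : MvPolynomial (Fin n) ℚ} {q : Fin r → MvPolynomial (Fin n) ℚ}
    {U : Set (Fin n → ℝ)} (hU : U ∈ 𝓝 a) {u : Fin r → (Fin n → ℝ) → ℝ}
    (hu : ∀ j, ContDiffOn ℝ (⊤ : ℕ∞) (u j) U)
    (hp : ∀ x ∈ U, aeval x p = ∑ j, u j x * aeval x (q j)) :
    ∃ h : MvPolynomial (Fin n) ℚ, aeval a h ≠ 0 ∧ h * p ∈ Ideal.span (range q) := by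
  let ρ : MvPolynomial (Fin n) ℚ →+* MvPolynomial (Fin n) ℝ := MvPolynomial.map (algebraMap ℚ ℝ)
  let σ : MvPolynomial (Fin n) ℝ →ₐ[ℝ] MvPolynomial (Fin n) ℝ := aeval fun i => X i + C (a i)
  let τ : MvPolynomial (Fin n) ℝ →ₐ[ℝ] MvPolynomial (Fin n) ℝ := aeval fun i => X i - C (a i)
  have hτσ : ∀ P, τ (σ P) = P := by
    intro P
    have : τ.comp σ = AlgHom.id ℝ _ := MvPolynomial.algHom_ext fun i => by
      simp [τ, σ, ← algebraMap_eq]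
    exact DFunLike.congr_fun this P
  have hσ : ∀ x P, eval (x - a) (σ P) = eval x P := by
    intro x P
    have : (aeval (x - a)).comp σ = (aeval x : MvPolynomial (Fin n) ℝ →ₐ[ℝ] ℝ) :=
      MvPolynomial.algHom_ext fun i => by simp [σ]
    simpa [aeval_eq_eval] using DFunLike.congr_fun this P
  have hτ : ∀ P, eval a (τ P) = eval 0 P := by
    intro P
    have : (aeval a).comp τ = (aeval 0 : MvPolynomial (Fin n) ℝ →ₐ[ℝ] ℝ) :=
      MvPolynomial.algHom_ext fun i => by simp [τ]
    simpa [aeval_eq_eval] using DFunLike.congr_fun this P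
  have hρ : ∀ x s, eval x (ρ s) = aeval x s := fun x s => by
    rw [eval_map, aeval_def]
  set J := Ideal.span (range fun j => σ (ρ (q j)))
  set I := idealOfVars (Fin n) ℝ
  have hmem : ∀ N : ℕ, ∃ b ∈ I ^ N, σ (ρ p) - b ∈ J := by
    intro N
    choose T hT using fun j => exists_mvPolynomial_isBigO a N hU (hu j)
    refine ⟨σ (ρ p) - ∑ j, T j * σ (ρ (q j)), ?_, ?_⟩
    · refine mem_pow_idealOfVars_of_isBigO N ?_
      have h1 : (fun x => eval (x - a) (σ (ρ p) - ∑ j, T j * σ (ρ (q j)))) =ᶠ[𝓝 a]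
          fun x => ∑ j, (u j x - eval (x - a) (T j)) * aeval x (q j) := by
        filter_upwards [hU] with x hx
        simp only [map_sub, map_sum, map_mul, hσ, hρ, hp x hx, sub_mul, Finset.sum_sub_distrib]
      have h2 : (fun x => eval (x - a) (σ (ρ p) - ∑ j, T j * σ (ρ (q j)))) =O[𝓝 a]
          fun x => ‖x - a‖ ^ N := by
        refine h1.trans_isBigO (Asymptotics.IsBigO.fun_sum fun j _ => ?_)
        have h3 : (fun x : Fin n → ℝ => aeval x (q j)) =O[𝓝 a] fun _ => (1 : ℝ) := by
          have hc : ContinuousAt (fun x : Fin n → ℝ => aeval x (q j)) a := by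
            simp only [← hρ]
            exact (MvPolynomial.continuous_eval _).continuousAt
          exact hc.isBigO_one ℝ
        simpa using (hT j).mul h3
      have h4 : Filter.Tendsto (fun y : Fin n → ℝ => y + a) (𝓝 0) (𝓝 a) := by
        have : Filter.Tendsto (fun y : Fin n → ℝ => y + a) (𝓝 0) (𝓝 (0 + a)) :=
          Continuous.tendsto (by fun_prop) 0
        rwa [zero_add] at this
      simpa [Function.comp_def] using h2.comp_tendsto h4
    · rw [sub_sub_cancel]
      exact J.sum_mem fun j _ => J.mul_mem_left _ (Ideal.subset_span ⟨j, rfl⟩)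
  have hinf : (Submodule.Quotient.mk (σ (ρ p)) : MvPolynomial (Fin n) ℝ ⧸ J) ∈
      (⨅ i : ℕ, I ^ i • ⊤ : Submodule (MvPolynomial (Fin n) ℝ) (MvPolynomial (Fin n) ℝ ⧸ J)) := by
    rw [Submodule.mem_iInf]
    intro N
    obtain ⟨b, hb, hJ⟩ := hmem N
    rw [(Submodule.Quotient.eq J).2 hJ]
    have : (Submodule.Quotient.mk b : MvPolynomial (Fin n) ℝ ⧸ J) =
        b • Submodule.Quotient.mk 1 := by
      rw [← Submodule.Quotient.mk_smul, smul_eq_mul, mul_one]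
    rw [this]
    exact Submodule.smul_mem_smul hb trivial
  obtain ⟨⟨c, hc⟩, hcp⟩ := (Ideal.mem_iInf_smul_pow_eq_bot_iff I _).1 hinf
  have hcJ : (1 - c) * σ (ρ p) ∈ J := by
    rw [sub_mul, one_mul]
    refine (Submodule.Quotient.eq J).1 ?_
    exact hcp.symm
  obtain ⟨d, hd⟩ := Ideal.mem_span_range_iff_exists_fun.1 hcJ
  have hd' : τ (1 - c) * ρ p = ∑ j, τ (d j) * ρ (q j) := by
    have := congrArg τ hd
    simp only [map_sum, map_mul, hτσ] at this
    exact this.symm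
  have hne : eval a (τ (1 - c)) ≠ 0 := by
    have hc0 : eval 0 c = 0 := by
      have : I ≤ RingHom.ker (eval (0 : Fin n → ℝ)) := by
        refine Ideal.span_le.2 ?_
        rintro _ ⟨i, rfl⟩
        simp
      exact this hc
    rw [hτ, map_sub, map_one, hc0, sub_zero]
    exact one_ne_zero
  obtain ⟨l, hl⟩ := exists_aeval_mapCoeffQ_ne_zero hne
  refine ⟨mapCoeffQ l (τ (1 - c)), hl, ?_⟩
  rw [← mapCoeffQ_mul_map]
  change mapCoeffQ l (τ (1 - c) * ρ p) ∈ _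
  rw [hd', mapCoeffQ_sum]
  refine Ideal.sum_mem _ fun j _ => ?_
  rw [mapCoeffQ_mul_map]
  exact Ideal.mul_mem_left _ _ (Ideal.subset_span ⟨j, rfl⟩)

theorem LocallyGenerates.mul_left {E : Type} [NormedAddCommGroup E] [NormedSpace ℝ E] {r : ℕ}
    {Z Z' : Set E} {a : E} {w : Fin r → E → ℝ} (hw : LocallyGenerates Z a w) (hZ : Z ⊆ Z')
    {h : E → ℝ} (hh : ContDiff ℝ (⊤ : ℕ∞) h) (ha : h a ≠ 0) :
    LocallyGenerates Z' a fun j x => h x * w j x := by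
  intro W hW
  have hne : ∀ᶠ x in 𝓝 a, x ∈ W ∧ h x ≠ 0 :=
    (Filter.eventually_of_mem hW fun _ h => h).and (hh.continuous.continuousAt.eventually_ne ha)
  obtain ⟨U, hUW, hU, haU, H⟩ := hw _ hne
  refine ⟨U, fun x hx => (hUW hx).1, hU, haU, fun f hf h0 => ?_⟩
  obtain ⟨u, hu, hfu⟩ := H f hf fun x hx hxZ => h0 x hx (hZ hxZ)
  refine ⟨fun j x => u j x / h x, fun j => (hu j).div hh.contDiffOn fun x hx => (hUW hx).2, ?_⟩
  intro x hx
  rw [hfu x hx]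
  refine Finset.sum_congr rfl fun j _ => ?_
  have := (hUW hx).2
  field_simp

theorem contDiff_aeval_rat {n : ℕ} (p : MvPolynomial (Fin n) ℚ) :
    ContDiff ℝ ω fun x : Fin n → ℝ => aeval x p := by
  have h : (fun x : Fin n → ℝ => aeval x p) =
      fun x => eval x (MvPolynomial.map (algebraMap ℚ ℝ) p) := by
    ext x; rw [eval_map, aeval_def]
  rw [h]
  exact (AnalyticOnNhd.eval_mvPolynomial _).contDiff

theorem fderiv_aeval_rat {n : ℕ} (p : MvPolynomial (Fin n) ℚ) (a v : Fin n → ℝ) :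
    fderiv ℝ (fun x : Fin n → ℝ => aeval x p) a v = ∑ i, polyGradQ p a i * v i := by
  have hd : ∀ p : MvPolynomial (Fin n) ℚ,
      DifferentiableAt ℝ (fun x : Fin n → ℝ => aeval x p) a :=
    fun p => (contDiff_aeval_rat p).differentiable (by simp) a
  induction p using MvPolynomial.induction_on with
  | C c => simp [polyGradQ]
  | add p q hp hq =>
    simp only [map_add, fderiv_fun_add (hd p) (hd q), add_apply, hp, hq,
      polyGradQ, add_mul, Finset.sum_add_distrib]
  | mul_X p j hp =>
    have hX : DifferentiableAt ℝ (fun x : Fin n → ℝ => x j) a := by fun_prop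
    have hXd : fderiv ℝ (fun x : Fin n → ℝ => x j) a = ContinuousLinearMap.proj j :=
      (ContinuousLinearMap.proj j : (Fin n → ℝ) →L[ℝ] ℝ).fderiv
    simp only [map_mul, aeval_X, fderiv_fun_mul (hd p) hX, add_apply,
      smul_apply, hp, hXd, ContinuousLinearMap.proj_apply, smul_eq_mul]
    simp only [polyGradQ, Derivation.leibniz, pderiv_X, map_add, smul_eq_mul, map_mul, aeval_X,
      add_mul, Finset.sum_add_distrib, Finset.mul_sum]
    congr 1
    · rw [Finset.sum_eq_single j]
      · simp
      · intro i _ hij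
        simp [hij.symm]
      · simp
    · exact Finset.sum_congr rfl fun i _ => by ring

theorem linearIndependent_fderiv_aeval_rat {n r : ℕ} {q : Fin r → MvPolynomial (Fin n) ℚ}
    {a : Fin n → ℝ} (h : LinearIndependent ℝ fun j => polyGradQ (q j) a) :
    LinearIndependent ℝ fun j => fderiv ℝ (fun x : Fin n → ℝ => aeval x (q j)) a := by
  rw [Fintype.linearIndependent_iff] at h ⊢
  refine fun c hc => h c (funext fun i => ?_)
  have := DFunLike.congr_fun hc (Pi.single i 1)
  simpa [fderiv_aeval_rat, Pi.single_apply] using this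

theorem IsQAlgebraicSet.exists_aeval_ne_zero {n : ℕ} {V : Set (Fin n → ℝ)}
    (hV : IsQAlgebraicSet V) {a : Fin n → ℝ} (ha : a ∉ V) :
    ∃ h : MvPolynomial (Fin n) ℚ, (∀ x ∈ V, aeval x h = 0) ∧ aeval a h ≠ 0 := by
  obtain ⟨S, rfl⟩ := hV
  simp only [mem_ofPred_eq, not_forall] at ha
  obtain ⟨p, hp, hpa⟩ := ha
  exact ⟨p, fun x hx => hx p hp, hpa⟩

theorem IsQNonsingular.exists_generators {n d r : ℕ} {V : Set (Fin n → ℝ)}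
    (hV : IsQNonsingular d V) (hr : n - d = r) {a : Fin n → ℝ} (ha : a ∈ V) :
    ∃ q : Fin r → MvPolynomial (Fin n) ℚ,
      (∀ j, ∀ x ∈ V, aeval x (q j) = 0) ∧
      LinearIndependent ℝ (fun j => fderiv ℝ (fun x : Fin n → ℝ => aeval x (q j)) a) ∧
      LocallyGenerates V a (fun j x => aeval x (q j)) ∧
      ∀ y : MvPolynomial (Fin n) ℚ, (∀ᶠ x in 𝓝 a, x ∈ V → aeval x y = 0) ∨
        ∀ᶠ x in 𝓝 a, x ∈ V → x ∈ closure (V ∩ {z | aeval z y ≠ 0}) := by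
  subst hr
  have h := hV.2.2 a ha
  rw [Fintype.card_fin] at h
  obtain ⟨q, hqV, hli, U, hU, haU, hVU⟩ := h
  have hli' := linearIndependent_fderiv_aeval_rat hli
  have hmem : ∀ x ∈ U, (∀ j, aeval x (q j) = 0) → x ∈ V := fun x hx h0 =>
    (hVU.symm.subset ⟨hx, h0⟩ : x ∈ V ∩ U).1
  refine ⟨q, hqV, hli', ?_, fun y => ?_⟩
  · refine (locallyGenerates_zeroSet (fun j => contDiff_aeval_rat (q j)) (fun j => hqV j a ha)
      hli').congr_set ?_
    filter_upwards [hU.mem_nhds haU] with x hx h0 using hmem x hx h0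
  · refine (eventually_eq_zero_or_mem_closure (fun j => contDiff_aeval_rat (q j))
      (fun j => hqV j a ha) hli' (contDiff_aeval_rat y)).imp (fun h => ?_) fun h => ?_
    · exact h.mono fun x hx hxV => hx fun j => hqV j x hxV
    · filter_upwards [h, hU.mem_nhds haU] with x hx hxU hxV
      have h1 : x ∈ U ∩ closure {z | (∀ j, aeval z (q j) = 0) ∧ aeval z y ≠ 0} :=
        ⟨hxU, hx fun j => hqV j x hxV⟩
      refine closure_mono ?_ (hU.inter_closure h1)
      exact fun z hz => ⟨hmem z hz.1 hz.2.1, hz.2.2⟩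

/-- The defining condition of `IsQNice` at one point. -/
def IsQNiceAt {n : ℕ} (L : Set (Fin n → ℝ)) (a : Fin n → ℝ) : Prop :=
  ∃ U : Set (Fin n → ℝ), IsOpen U ∧ a ∈ U ∧
    ∀ f : (Fin n → ℝ) → ℝ, ContDiff ℝ (⊤ : ℕ∞) f → (∀ x ∈ L, f x = 0) →
      ∃ (s : ℕ) (pp : Fin s → MvPolynomial (Fin n) ℚ) (u : Fin s → (Fin n → ℝ) → ℝ),
        (∀ i, ∀ x ∈ L, aeval x (pp i) = 0) ∧
        (∀ i, ContDiffOn ℝ (⊤ : ℕ∞) (u i) U) ∧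
        ∀ x ∈ U, f x = ∑ i, u i x * aeval x (pp i)

theorem LocallyGenerates.isQNiceAt {n r : ℕ} {Z L : Set (Fin n → ℝ)} {a : Fin n → ℝ}
    {q : Fin r → MvPolynomial (Fin n) ℚ} (hq : LocallyGenerates Z a fun j x => aeval x (q j))
    (hZ : Z ⊆ L) {h : MvPolynomial (Fin n) ℚ} (ha : aeval a h ≠ 0)
    (hL : ∀ j, ∀ x ∈ L, aeval x (h * q j) = 0) : IsQNiceAt L a := by
  obtain ⟨U, -, hU, haU, H⟩ := hq.mul_left hZ ((contDiff_aeval_rat h).of_le le_top) ha univ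
    Filter.univ_mem
  refine ⟨U, hU, haU, fun f hf h0 => ?_⟩
  obtain ⟨u, hu, hfu⟩ := H f hf.contDiffOn fun x _ hx => h0 x hx
  exact ⟨r, fun j => h * q j, u, hL, hu, by simpa only [map_mul] using hfu⟩

theorem IsQNonsingular.isQNiceAt_union_of_notMem {n d : ℕ} {X Y : Set (Fin n → ℝ)}
    (hX : IsQNonsingular d X) (hY : IsQAlgebraicSet Y) {a : Fin n → ℝ} (haX : a ∈ X)
    (haY : a ∉ Y) : IsQNiceAt (X ∪ Y) a := by
  obtain ⟨q, hqX, -, hgen, -⟩ := hX.exists_generators rfl haX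
  obtain ⟨h, hhY, hha⟩ := hY.exists_aeval_ne_zero haY
  refine hgen.isQNiceAt subset_union_left hha ?_
  rintro j x (hx | hx)
  · rw [map_mul, hqX j x hx, mul_zero]
  · rw [map_mul, hhY x hx, zero_mul]

/-- Equations of `V` near a point of a codimension one submanifold `Y` of `V`, completed by one
equation of `Y` to a system of generators. -/
theorem exists_hypersurface_generators {n r : ℕ} {Y : Set (Fin n → ℝ)} {a : Fin n → ℝ}
    (haY : a ∈ Y) {v : Fin r → MvPolynomial (Fin n) ℚ}
    {q : Fin (r + 1) → MvPolynomial (Fin n) ℚ}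
    (hvY : ∀ j, ∀ x ∈ Y, aeval x (v j) = 0) (hqY : ∀ j, ∀ x ∈ Y, aeval x (q j) = 0)
    (hv : LinearIndependent ℝ fun j => fderiv ℝ (fun x : Fin n → ℝ => aeval x (v j)) a)
    (hq : LinearIndependent ℝ fun j => fderiv ℝ (fun x : Fin n → ℝ => aeval x (q j)) a)
    (hgen : LocallyGenerates Y a fun j x => aeval x (q j)) :
    ∃ y : MvPolynomial (Fin n) ℚ, (∀ x ∈ Y, aeval x y = 0) ∧
      LocallyGenerates Y a fun j x =>
        aeval x ((Fin.cons y v : Fin (r + 1) → MvPolynomial (Fin n) ℚ) j) := by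
  obtain ⟨j, hj⟩ : ∃ j, fderiv ℝ (fun x : Fin n → ℝ => aeval x (q j)) a ∉
      Submodule.span ℝ (range fun j => fderiv ℝ (fun x : Fin n → ℝ => aeval x (v j)) a) := by
    by_contra! hcon
    have h1 := Submodule.finrank_mono (Submodule.span_le.2 (range_subset_iff.2 hcon))
    rw [finrank_span_eq_card hq, finrank_span_eq_card hv] at h1
    simp at h1
  refine ⟨q j, hqY j, hgen.of_linearIndependent
    (fun j => (contDiff_aeval_rat _).differentiable (by simp) a) (fun j => hqY j a haY)
    (fun j => (contDiff_aeval_rat _).of_le le_top) ?_ ?_⟩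
  · intro i
    refine Fin.cases ?_ (fun i => ?_) i
    · simpa using hqY j
    · simpa using hvY i
  · have := linearIndependent_finCons.2 ⟨hv, hj⟩
    have heq : (fun i => fderiv ℝ (fun x : Fin n → ℝ =>
        aeval x ((Fin.cons (q j) v : Fin (r + 1) → MvPolynomial (Fin n) ℚ) i)) a) =
        Fin.cons (fderiv ℝ (fun x : Fin n → ℝ => aeval x (q j)) a)
          fun j => fderiv ℝ (fun x : Fin n → ℝ => aeval x (v j)) a :=
      funext (Fin.cases rfl fun _ => rfl)
    rw [heq]
    exact this

theorem isQNiceAt_union_of_dense {n r s : ℕ} {X Y : Set (Fin n → ℝ)} {a : Fin n → ℝ}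
    {v : Fin r → MvPolynomial (Fin n) ℚ} {w : Fin s → MvPolynomial (Fin n) ℚ}
    {y : MvPolynomial (Fin n) ℚ}
    (hv : ∀ j, ∀ x ∈ X ∪ Y, aeval x (v j) = 0) (hw : ∀ j, ∀ x ∈ X, aeval x (w j) = 0)
    (hy : ∀ x ∈ Y, aeval x y = 0)
    (hX : LocallyGenerates X a fun j x => aeval x (w j))
    (hY : LocallyGenerates Y a fun j x =>
      aeval x ((Fin.cons y v : Fin (r + 1) → MvPolynomial (Fin n) ℚ) j))
    (hdense : ∀ᶠ x in 𝓝 a, x ∈ X → x ∈ closure (X ∩ {z | aeval z y ≠ 0})) :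
    IsQNiceAt (X ∪ Y) a := by
  obtain ⟨U₁, -, hU₁, haU₁, H₁⟩ := hY univ Filter.univ_mem
  obtain ⟨U, hUW, hU, haU, H⟩ := hX _ (Filter.inter_mem (hU₁.mem_nhds haU₁) hdense)
  refine ⟨U, hU, haU, fun f hf h0 => ?_⟩
  obtain ⟨α, hα, hfα⟩ := H₁ f hf.contDiffOn fun x _ hx => h0 x (.inr hx)
  simp only [Fin.sum_univ_succ, Fin.cons_zero, Fin.cons_succ] at hfα
  have hUU₁ : U ⊆ U₁ := fun x hx => (hUW hx).1
  obtain ⟨γ, hγ, hαγ⟩ := H (α 0) ((hα 0).mono hUU₁) (by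
    intro x hx hxX
    by_contra hne
    have hcl := mem_closure_iff_frequently.1 ((hUW hx).2 hxX)
    have hev := ((hα 0).continuousOn.continuousAt (hU₁.mem_nhds (hUU₁ hx))).eventually_ne hne
    obtain ⟨z, ⟨⟨hzX, hzy⟩, hz0⟩, hzU⟩ :=
      ((hcl.and_eventually hev).and_eventually (hU₁.mem_nhds (hUU₁ hx))).exists
    have := hfα z hzU
    rw [h0 z (.inl hzX), Finset.sum_eq_zero fun j _ => by rw [hv j z (.inl hzX), mul_zero],
      add_zero] at this
    exact mul_ne_zero hz0 hzy this.symm)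
  refine ⟨r + s, Fin.append v fun j => w j * y,
    Fin.append (fun j => α j.succ) γ, ?_, ?_, ?_⟩
  · intro i
    refine Fin.addCases (fun i => ?_) (fun i => ?_) i
    · simpa only [Fin.append_left] using hv i
    · rw [Fin.append_right]
      rintro x (hx | hx)
      · rw [map_mul, hw i x hx, zero_mul]
      · rw [map_mul, hy x hx, mul_zero]
  · intro i
    refine Fin.addCases (fun i => ?_) (fun i => ?_) i
    · simpa only [Fin.append_left] using (hα i.succ).mono hUU₁
    · simpa only [Fin.append_right] using hγ i
  · intro x hx
    rw [hfα x (hUU₁ hx), hαγ x hx, Fin.sum_univ_add, add_comm]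
    simp only [Fin.append_left, Fin.append_right, map_mul, Finset.sum_mul, mul_assoc]

theorem isQNiceAt_union_of_eventually_eq_zero {n r s : ℕ} {X Y : Set (Fin n → ℝ)} {a : Fin n → ℝ}
    {v : Fin r → MvPolynomial (Fin n) ℚ} {w : Fin s → MvPolynomial (Fin n) ℚ}
    {y : MvPolynomial (Fin n) ℚ}
    (hv : ∀ j, ∀ x ∈ X ∪ Y, aeval x (v j) = 0) (hw : ∀ j, ∀ x ∈ X, aeval x (w j) = 0)
    (hy : ∀ x ∈ Y, aeval x y = 0)
    (hX : LocallyGenerates X a fun j x => aeval x (w j))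
    (hY : LocallyGenerates Y a fun j x =>
      aeval x ((Fin.cons y v : Fin (r + 1) → MvPolynomial (Fin n) ℚ) j))
    (hzero : ∀ᶠ x in 𝓝 a, x ∈ X → aeval x y = 0) :
    IsQNiceAt (X ∪ Y) a := by
  obtain ⟨U, hUW, hU, haU, H⟩ := hX _ hzero
  obtain ⟨u, hu, hyu⟩ := H (fun x => aeval x y) ((contDiff_aeval_rat y).of_le le_top).contDiffOn
    fun x hx hxX => hUW hx hxX
  obtain ⟨h, hha, hmem⟩ := exists_mul_mem_span_of_smooth_combination (hU.mem_nhds haU) hu hyu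
  refine hY.isQNiceAt subset_union_right hha fun j x hx => ?_
  refine Fin.cases ?_ (fun j => ?_) j
  · rw [Fin.cons_zero]
    rcases hx with hx | hx
    · have : Ideal.span (range w) ≤ RingHom.ker (aeval x : MvPolynomial (Fin n) ℚ →ₐ[ℚ] ℝ) := by
        refine Ideal.span_le.2 ?_
        rintro _ ⟨i, rfl⟩
        exact hw i x hx
      exact this hmem
    · rw [map_mul, hy x hx, mul_zero]
  · rw [Fin.cons_succ, map_mul, hv j x hx, mul_zero]

/-- **`ℚ`-niceness of the union of a `ℚ`-nonsingular set and a `ℚ`-nonsingular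
hypersurface.** -/
theorem qNice_union_of_qNonsingular_and_hypersurface
    {n d cc : ℕ} (M X Y : Set (Fin n → ℝ))
    (hMc : IsCompact M) (hM : IsSmoothSubmanifold d M)
    (hXM : X ⊆ M) (hX : IsQNonsingular (d - cc) X)
    (hYM : Y ⊆ M) (hY : IsQNonsingular (d - 1) Y)
    (hgerm : ∃ (U V : Set (Fin n → ℝ)),
      IsOpen U ∧ X ∪ Y ⊆ U ∧ IsQNonsingular d V ∧ M ∩ U = V ∩ U) :
    IsQNice (X ∪ Y) := by
  obtain ⟨U, V, -, hXYU, hV, hMV⟩ := hgerm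
  have hXYV : X ∪ Y ⊆ V := fun x hx =>
    (hMV.subset ⟨union_subset hXM hYM hx, hXYU hx⟩ : x ∈ V ∩ U).1
  intro a ha
  change IsQNiceAt (X ∪ Y) a
  by_cases haX : a ∈ X
  swap
  · rw [union_comm]
    exact hY.isQNiceAt_union_of_notMem hX.1 (ha.resolve_left haX) haX
  by_cases haY : a ∈ Y
  swap
  · exact hX.isQNiceAt_union_of_notMem hY.1 haX haY
  obtain ⟨v, hvV, hvli, -, -⟩ := hV.exists_generators rfl (hXYV ha)
  have hvXY : ∀ j, ∀ x ∈ X ∪ Y, aeval x (v j) = 0 := fun j x hx => hvV j x (hXYV hx)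
  have hvY : ∀ j, ∀ x ∈ Y, aeval x (v j) = 0 := fun j x hx => hvXY j x (.inr hx)
  rcases (by omega : n - (d - 1) = n - d ∨ n - (d - 1) = n - d + 1) with hr | hr
  · obtain ⟨q, hqY, -, hgen, -⟩ := hY.exists_generators hr haY
    have hvgen := hgen.of_linearIndependent
      (fun j => (contDiff_aeval_rat _).differentiable (by simp) a) (fun j => hqY j a haY)
      (fun j => (contDiff_aeval_rat (v j)).of_le le_top) hvY hvli
    exact hvgen.isQNiceAt (h := 1) subset_union_right (by simp) (by simpa using hvXY)
  · obtain ⟨q, hqY, hqli, hgen, -⟩ := hY.exists_generators hr haY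
    obtain ⟨y, hyY, hygen⟩ := exists_hypersurface_generators haY hvY hqY hvli hqli hgen
    obtain ⟨w, hwX, -, hwgen, hdich⟩ := hX.exists_generators rfl haX
    rcases hdich y with hzero | hdense
    · exact isQNiceAt_union_of_eventually_eq_zero hvXY hwX hyY hwgen hygen hzero
    · exact isQNiceAt_union_of_dense hvXY hwX hyY hwgen hygen hdense
end

section
/- Separation of components over ℚ: Let V ⊆ ℝ^N and Z ⊆ ℝ^N be ℚ-nonsingular ℚ-algebraic sets of the same dimension d with Z ⊊ V. Then V ∖ Z is again a ℚ-nonsingular ℚ-algebraic subset of ℝ^N of dimension d; in particular, V ∖ Z is closed in ℝ^N and is the common zero set of finitely many polynomials with rational coefficients. -/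
open MvPolynomial

open Filter Topology

/-- A homogeneous polynomial of degree `n` scales by `t ^ n`. -/
lemma eval_smul_of_isHomogeneous {σ : Type*} {n : ℕ} {f : MvPolynomial σ ℝ}
    (hf : f.IsHomogeneous n) (t : ℝ) (x : σ → ℝ) :
    eval (t • x) f = t ^ n * eval x f := by
  rw [eval_eq, eval_eq, Finset.mul_sum]
  refine Finset.sum_congr rfl fun d hd => ?_
  have hdeg : d.degree = n := by
    rw [Finsupp.degree_eq_weight_one]
    exact hf (mem_support_iff.mp hd)
  simp only [Pi.smul_apply, smul_eq_mul, mul_pow, Finset.prod_mul_distrib]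
  rw [Finset.prod_pow_eq_pow_sum, ← hdeg, Finsupp.degree_apply]
  ring

/-- If `f` vanishes to order `n` at the origin and vanishes along a curve `t ↦ t • β t` with
`β t → v`, then its homogeneous component of degree `n` vanishes at `v`. -/
lemma eval_homogeneousComponent_eq_zero_of_curve {σ : Type*} [Finite σ] {n : ℕ}
    {f : MvPolynomial σ ℝ} (hf : f ∈ idealOfVars σ ℝ ^ n) {β : ℝ → σ → ℝ} {v : σ → ℝ}
    (hβ : Tendsto β (𝓝[≠] 0) (𝓝 v)) (hz : ∀ᶠ t in 𝓝[≠] (0 : ℝ), eval (t • β t) f = 0) :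
    eval v (homogeneousComponent n f) = 0 := by
  set D := max f.totalDegree n with hD
  have hlow : ∀ j, j < n → homogeneousComponent j f = 0 := fun j hj =>
    homogeneousComponent_eq_zero' _ _ fun d hd hdj =>
      absurd ((mem_pow_idealOfVars_iff n f).mp hf d hd) (by omega)
  have hsum : f = ∑ j ∈ Finset.range (D + 1), homogeneousComponent j f := by
    conv_lhs => rw [← sum_homogeneousComponent f]
    refine Finset.sum_subset (Finset.range_mono (by omega)) fun j _ hj => ?_
    exact homogeneousComponent_eq_zero _ _ (by simpa using hj)
  have hev : ∀ᶠ t in 𝓝[≠] (0 : ℝ),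
      ∑ j ∈ Finset.range (D + 1), t ^ (j - n) * eval (β t) (homogeneousComponent j f) = 0 := by
    filter_upwards [hz, self_mem_nhdsWithin] with t ht ht0
    have ht0 : t ≠ 0 := ht0
    refine (mul_eq_zero.mp ?_).resolve_left (pow_ne_zero n ht0)
    rw [← ht]
    conv_rhs => rw [hsum, map_sum]
    rw [Finset.mul_sum]
    refine Finset.sum_congr rfl fun j _ => ?_
    rcases lt_or_ge j n with hj | hj
    · simp [hlow j hj]
    · rw [eval_smul_of_isHomogeneous (homogeneousComponent_isHomogeneous j f), ← mul_assoc,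
        ← pow_add, Nat.add_sub_cancel' hj]
  have hlim : Tendsto (fun t : ℝ => ∑ j ∈ Finset.range (D + 1),
      t ^ (j - n) * eval (β t) (homogeneousComponent j f)) (𝓝[≠] 0)
      (𝓝 (∑ j ∈ Finset.range (D + 1), (0 : ℝ) ^ (j - n) * eval v (homogeneousComponent j f))) := by
    refine tendsto_finsetSum _ fun j _ => Tendsto.mul ?_ ?_
    · exact ((continuous_pow (j - n)).tendsto 0).mono_left nhdsWithin_le_nhds
    · exact ((continuous_eval _).tendsto v).comp hβ
  have h0 := tendsto_nhds_unique (hlim.congr' hev) tendsto_const_nhds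
  rw [Finset.sum_eq_single n] at h0
  · simpa using h0
  · intro j _ hj
    rcases lt_or_gt_of_ne hj with h | h
    · simp [hlow j h]
    · simp [Nat.sub_ne_zero_of_lt h]
  · intro h
    exact absurd (Finset.mem_range.mpr (by omega)) h

/-- An algebra endomorphism fixing the origin and congruent to the identity modulo
`I + 𝔪 ^ 2` on the variables is congruent to the identity modulo `I + 𝔪 ^ (n + 1)` on `𝔪 ^ n`. -/
lemma sub_mem_sup_pow_idealOfVars {σ : Type*} (I : Ideal (MvPolynomial σ ℝ))
    (T : MvPolynomial σ ℝ →ₐ[ℝ] MvPolynomial σ ℝ)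
    (hT : ∀ i, T (X i) ∈ idealOfVars σ ℝ)
    (hTI : ∀ i, X i - T (X i) ∈ I ⊔ idealOfVars σ ℝ ^ 2) (n : ℕ) :
    ∀ f ∈ idealOfVars σ ℝ ^ n, f - T f ∈ I ⊔ idealOfVars σ ℝ ^ (n + 1) := by
  set m := idealOfVars σ ℝ with hm
  have hX : ∀ i, (X i : MvPolynomial σ ℝ) ∈ m := fun i => Ideal.subset_span ⟨i, rfl⟩
  have hbase : ∀ f, f - T f ∈ m := by
    intro f
    induction f using MvPolynomial.induction_on with
    | C r => rw [show T (C r) = C r from T.commutes r, sub_self]; exact zero_mem _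
    | add p q hp hq =>
      rw [map_add, add_sub_add_comm]
      exact add_mem hp hq
    | mul_X p i hp =>
      rw [map_mul]
      exact sub_mem (m.mul_mem_left _ (hX i)) (m.mul_mem_left _ (hT i))
  have hTm : ∀ f ∈ m, T f ∈ m := fun f hf => by
    simpa using sub_mem hf (hbase f)
  have hone : ∀ f ∈ m, f - T f ∈ I ⊔ m ^ 2 := by
    intro f hf
    refine Submodule.span_induction (p := fun f _ => f - T f ∈ I ⊔ m ^ 2) ?_ ?_ ?_ ?_ hf
    · rintro _ ⟨i, rfl⟩
      exact hTI i
    · simp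
    · intro x y _ _ hx hy
      rw [map_add, add_sub_add_comm]
      exact add_mem hx hy
    · intro a x hx hx'
      have : a • x - T (a • x) = (a - T a) * x + T a * (x - T x) := by
        simp only [smul_eq_mul, map_mul]; ring
      rw [this]
      refine add_mem (Ideal.mem_sup_right ?_) (Ideal.mul_mem_left _ _ hx')
      rw [pow_two]
      exact Ideal.mul_mem_mul (hbase a) hx
  induction n with
  | zero => exact fun f _ => Ideal.mem_sup_right (by simpa using hbase f)
  | succ n ih =>
    intro f hf
    rw [pow_succ'] at hf
    refine Submodule.mul_induction_on hf ?_ ?_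
    · intro u hu v hv
      have : u * v - T (u * v) = v * (u - T u) + T u * (v - T v) := by
        rw [map_mul]; ring
      rw [this]
      refine add_mem ?_ ?_
      · have h := Ideal.mul_mem_mul hv (hone u hu)
        refine (?_ : m ^ n * (I ⊔ m ^ 2) ≤ _) h
        rw [Ideal.mul_sup, ← pow_add]
        exact sup_le_sup Ideal.mul_le_right le_rfl
      · have h := Ideal.mul_mem_mul (hTm u hu) (ih v hv)
        refine (?_ : m * (I ⊔ m ^ (n + 1)) ≤ _) h
        rw [Ideal.mul_sup, ← pow_succ']
        exact sup_le_sup Ideal.mul_le_right le_rfl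
    · intro x y hx hy
      rw [map_add, add_sub_add_comm]
      exact add_mem hx hy

/-- Let `q` be polynomials with independent linear parts `A` at the origin. If `g` and the `q i`
vanish along curves through the origin in every direction of the kernel of `A`, then `g` lies in
the ideal generated by `q` locally at the origin. -/
lemma exists_mul_mem_span_of_curves {σ : Type*} [Fintype σ] {c : ℕ}
    (q : Fin c → MvPolynomial σ ℝ) (g : MvPolynomial σ ℝ) (A w : Fin c → σ → ℝ)
    (hw : ∀ i j, ∑ n, A i n * w j n = if i = j then 1 else 0)
    (hqA : ∀ i, q i - ∑ n, C (A i n) * X n ∈ idealOfVars σ ℝ ^ 2)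
    (hcurve : ∀ v : σ → ℝ, (∀ i, ∑ n, A i n * v n = 0) →
      ∃ β : ℝ → σ → ℝ, Tendsto β (𝓝[≠] 0) (𝓝 v) ∧
        ∀ᶠ t in 𝓝[≠] (0 : ℝ), eval (t • β t) g = 0 ∧ ∀ i, eval (t • β t) (q i) = 0) :
    ∃ h : MvPolynomial σ ℝ, constantCoeff h = 1 ∧ h * g ∈ Ideal.span (Set.range q) := by
  set m := idealOfVars σ ℝ with hm
  set I := Ideal.span (Set.range q) with hI
  have hX : ∀ i, (X i : MvPolynomial σ ℝ) ∈ m := fun i => Ideal.subset_span ⟨i, rfl⟩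
  set L : Fin c → MvPolynomial σ ℝ := fun i => ∑ n, C (A i n) * X n with hL
  have hLm : ∀ i, L i ∈ m := fun i => sum_mem fun n _ => m.mul_mem_left _ (hX n)
  have hLI : ∀ i, L i ∈ I ⊔ m ^ 2 := fun i => by
    have h1 : q i ∈ I ⊔ m ^ 2 := Ideal.mem_sup_left (Ideal.subset_span ⟨i, rfl⟩)
    simpa using sub_mem h1 (Ideal.mem_sup_right (hqA i))
  let T : MvPolynomial σ ℝ →ₐ[ℝ] MvPolynomial σ ℝ :=
    aeval fun n => X n - ∑ i, C (w i n) * L i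
  have hTX : ∀ n, T (X n) = X n - ∑ i, C (w i n) * L i := fun n => aeval_X _ _
  have hTeval : ∀ (x : σ → ℝ) f,
      eval x (T f) = eval (fun n => x n - ∑ i, w i n * ∑ k, A i k * x k) f := by
    intro x f
    induction f using MvPolynomial.induction_on with
    | C r => rw [show T (C r) = C r from T.commutes r, eval_C, eval_C]
    | add p q hp hq => rw [map_add, map_add, map_add, hp, hq]
    | mul_X p i hp => rw [map_mul, map_mul, map_mul, hp, hTX]; simp [hL]
  have hsub := sub_mem_sup_pow_idealOfVars I T
    (fun n => by
      rw [hTX]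
      exact sub_mem (hX n) (sum_mem fun i _ => m.mul_mem_left _ (hLm i)))
    (fun n => by
      rw [hTX, sub_sub_cancel]
      exact sum_mem fun i _ => Ideal.mul_mem_left _ _ (hLI i))
  have hker : ∀ (x : σ → ℝ) i, ∑ n, A i n * (x n - ∑ j, w j n * ∑ k, A j k * x k) = 0 := by
    intro x i
    simp only [mul_sub, Finset.sum_sub_distrib, Finset.mul_sum (s := (Finset.univ : Finset (Fin c)))]
    rw [Finset.sum_comm]
    simp only [← mul_assoc, ← Finset.sum_mul, hw]
    simp
  have key : ∀ n, g ∈ I ⊔ m ^ n := by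
    intro n
    induction n with
    | zero => simp
    | succ n ih =>
      obtain ⟨s, hs, e, he, rfl⟩ := Submodule.mem_sup.mp ih
      refine add_mem (Ideal.mem_sup_left hs) ?_
      have hev : ∀ v : σ → ℝ, (∀ i, ∑ n, A i n * v n = 0) →
          eval v (homogeneousComponent n e) = 0 := by
        intro v hv
        obtain ⟨β, hβ, hz⟩ := hcurve v hv
        refine eval_homogeneousComponent_eq_zero_of_curve he hβ ?_
        filter_upwards [hz] with t ht
        have hst : eval (t • β t) s = 0 := by
          have : I ≤ RingHom.ker (eval (t • β t)) := Ideal.span_le.mpr (by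
            rintro _ ⟨i, rfl⟩
            exact ht.2 i)
          exact this hs
        simpa [hst] using ht.1
      have hcomp : homogeneousComponent n e ∈ m ^ n := by
        rw [mem_pow_idealOfVars_iff']
        intro x hx
        rw [coeff_homogeneousComponent, if_neg (by omega)]
      have hT0 : T (homogeneousComponent n e) = 0 := by
        refine MvPolynomial.funext fun x => ?_
        rw [hTeval, map_zero]
        exact hev _ (hker x)
      have h1 := hsub n _ hcomp
      rw [hT0, sub_zero] at h1
      have h2 : e - homogeneousComponent n e ∈ m ^ (n + 1) := by
        rw [mem_pow_idealOfVars_iff']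
        intro x hx
        rw [coeff_sub, coeff_homogeneousComponent]
        split_ifs with h
        · simp
        · rw [(mem_pow_idealOfVars_iff' n e).mp he x (by omega), sub_zero]
      simpa using add_mem h1 (Ideal.mem_sup_right (S := I) h2)
  have hmem : (Ideal.Quotient.mk I g) ∈
      (⨅ i : ℕ, m ^ i • ⊤ : Submodule (MvPolynomial σ ℝ) (MvPolynomial σ ℝ ⧸ I)) := by
    rw [Submodule.mem_iInf]
    intro n
    obtain ⟨s, hs, e, he, rfl⟩ := Submodule.mem_sup.mp (key n)
    have : Ideal.Quotient.mk I (s + e) = e • (1 : MvPolynomial σ ℝ ⧸ I) := by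
      rw [map_add, Ideal.Quotient.eq_zero_iff_mem.mpr hs, zero_add]
      exact congrArg (Ideal.Quotient.mk I) (mul_one e).symm
    rw [this]
    exact Submodule.smul_mem_smul he trivial
  obtain ⟨⟨r, hr⟩, hrg⟩ := (Ideal.mem_iInf_smul_pow_eq_bot_iff m _).mp hmem
  refine ⟨1 - r, ?_, ?_⟩
  · have : constantCoeff r = 0 := by
      have : m ≤ RingHom.ker (constantCoeff (σ := σ) (R := ℝ)) := Ideal.span_le.mpr (by
        rintro _ ⟨i, rfl⟩
        simp)
      exact this hr
    simp [this]
  · rw [← Ideal.Quotient.eq_zero_iff_mem, sub_mul, one_mul, map_sub, sub_eq_zero]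
    exact hrg.symm

/-- Descent of an ideal membership along `ℚ ⊆ ℝ`, keeping the multiplier nonzero at a point. -/
lemma exists_rat_mul_mem_span {σ : Type*} [Fintype σ] {c : ℕ} (q : Fin c → MvPolynomial σ ℚ)
    (g : MvPolynomial σ ℚ) (a : σ → ℝ) (h : MvPolynomial σ ℝ) (ha : eval a h ≠ 0)
    (hg : h * MvPolynomial.map (algebraMap ℚ ℝ) g ∈
      Ideal.span (Set.range fun i => MvPolynomial.map (algebraMap ℚ ℝ) (q i))) :
    ∃ h' : MvPolynomial σ ℚ, aeval a h' ≠ 0 ∧ h' * g ∈ Ideal.span (Set.range q) := by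
  classical
  let b := Module.Free.chooseBasis ℚ ℝ
  let Λ : (ℝ →ₗ[ℚ] ℚ) → MvPolynomial σ ℝ → MvPolynomial σ ℚ := fun l f =>
    ∑ s ∈ f.support, monomial s (l (coeff s f))
  have hΛ : ∀ l f s, coeff s (Λ l f) = l (coeff s f) := by
    intro l f s
    simp only [Λ, coeff_sum, coeff_monomial, Finset.sum_ite_eq']
    split_ifs with hs
    · rfl
    · rw [notMem_support_iff.mp hs, map_zero]
  have hΛmul : ∀ l f p, Λ l (f * MvPolynomial.map (algebraMap ℚ ℝ) p) = Λ l f * p := by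
    intro l f p
    ext s
    rw [hΛ, coeff_mul, coeff_mul, map_sum]
    refine Finset.sum_congr rfl fun x _ => ?_
    rw [hΛ, coeff_map, mul_comm, ← Algebra.smul_def, map_smul, smul_eq_mul, mul_comm]
  have hmem : ∀ l, Λ l h * g ∈ Ideal.span (Set.range q) := by
    intro l
    obtain ⟨u, hu⟩ := (Ideal.mem_span_range_iff_exists_fun).mp hg
    rw [← hΛmul, ← hu]
    have : Λ l (∑ i, u i * MvPolynomial.map (algebraMap ℚ ℝ) (q i)) = ∑ i, Λ l (u i) * q i := by
      ext s
      rw [hΛ, coeff_sum, coeff_sum, map_sum]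
      refine Finset.sum_congr rfl fun i _ => ?_
      rw [← hΛmul, hΛ]
    rw [this]
    exact sum_mem fun i _ => Ideal.mul_mem_left _ _ (Ideal.subset_span ⟨i, rfl⟩)
  by_contra! hcon
  refine ha ?_
  let K := h.support.biUnion fun s => (b.repr (coeff s h)).support
  have hexp : h = ∑ k ∈ K, C (b k) * MvPolynomial.map (algebraMap ℚ ℝ) (Λ (b.coord k) h) := by
    ext s
    simp only [coeff_sum, coeff_C_mul, coeff_map, hΛ, Module.Basis.coord_apply]
    by_cases hs : s ∈ h.support
    · conv_lhs => rw [← b.linearCombination_repr (coeff s h), Finsupp.linearCombination_apply]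
      rw [Finsupp.sum_of_support_subset _ (Finset.subset_biUnion_of_mem
        (fun s => (b.repr (coeff s h)).support) hs) _ (by simp)]
      refine Finset.sum_congr rfl fun k _ => ?_
      rw [Algebra.smul_def, mul_comm]
    · rw [notMem_support_iff.mp hs]
      simp
  rw [hexp, map_sum]
  refine Finset.sum_eq_zero fun k _ => ?_
  rw [map_mul, eval_map, ← aeval_def]
  by_cases hk : aeval a (Λ (b.coord k) h) = 0
  · rw [hk, mul_zero]
  · exact absurd (hmem _) (hcon _ hk)

/-- The expansion of a rational polynomial around the real point `a`. -/
noncomputable def shiftAt {σ : Type*} (a : σ → ℝ) : MvPolynomial σ ℚ →ₐ[ℚ] MvPolynomial σ ℝ :=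
  aeval fun i => X i + C (a i)

lemma eval_shiftAt {σ : Type*} (a x : σ → ℝ) (p : MvPolynomial σ ℚ) :
    eval x (shiftAt a p) = aeval (x + a) p := by
  induction p using MvPolynomial.induction_on with
  | C r => simp [shiftAt]
  | add p q hp hq => rw [map_add, map_add, map_add, hp, hq]
  | mul_X p i hp => rw [map_mul, map_mul, map_mul, hp]; simp [shiftAt]

lemma polyGradQ_mul_X {σ : Type*} [DecidableEq σ] (a : σ → ℝ) (p : MvPolynomial σ ℚ) (i n : σ) :
    polyGradQ (p * X i) a n = polyGradQ p a n * a i + if n = i then aeval a p else 0 := by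
  simp only [polyGradQ, Derivation.leibniz, pderiv_X, Pi.single_apply, smul_eq_mul, map_add,
    map_mul, aeval_X, eq_comm (a := n)]
  split_ifs <;> simp <;> ring

/-- First order Taylor expansion of a rational polynomial at a real point. -/
lemma shiftAt_sub_linear_mem {σ : Type*} [Fintype σ] [DecidableEq σ] (a : σ → ℝ)
    (p : MvPolynomial σ ℚ) :
    shiftAt a p - C (aeval a p) - ∑ n, C (polyGradQ p a n) * X n ∈ idealOfVars σ ℝ ^ 2 := by
  have hX : ∀ i, (X i : MvPolynomial σ ℝ) ∈ idealOfVars σ ℝ :=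
    fun i => Ideal.subset_span ⟨i, rfl⟩
  induction p using MvPolynomial.induction_on with
  | C r => simp [shiftAt, polyGradQ]
  | add p q hp hq =>
    have := add_mem hp hq
    convert this using 1
    simp only [map_add, polyGradQ, add_mul, Finset.sum_add_distrib]
    ring
  | mul_X p i hp =>
    have hp1 : shiftAt a p - C (aeval a p) ∈ idealOfVars σ ℝ := by
      have h := add_mem (Ideal.pow_le_self two_ne_zero hp) (sum_mem fun n (_ : n ∈ Finset.univ) =>
        (idealOfVars σ ℝ).mul_mem_left (C (polyGradQ p a n)) (hX n))
      simpa using h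
    have h2 := add_mem (Ideal.mul_mem_right (C (a i)) _ hp)
      (by simpa [pow_two] using Ideal.mul_mem_mul hp1 (hX i) :
        (shiftAt a p - C (aeval a p)) * X i ∈ idealOfVars σ ℝ ^ 2)
    convert h2 using 1
    simp only [polyGradQ_mul_X, map_mul, map_add, add_mul, Finset.sum_add_distrib, aeval_X]
    have h3 : ∑ n, C (if n = i then aeval a p else 0) * (X n : MvPolynomial σ ℝ)
        = C (aeval a p) * X i := by
      simp [apply_ite C, ite_mul]
    have h4 : shiftAt a (X i) = X i + C (a i) := aeval_X _ _
    rw [h3, h4, sub_mul, sub_mul, Finset.sum_mul]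
    have h5 : ∑ n, C (polyGradQ p a n) * C (a i) * (X n : MvPolynomial σ ℝ)
        = ∑ n, C (polyGradQ p a n) * X n * C (a i) :=
      Finset.sum_congr rfl fun n _ => by ring
    rw [h5]
    ring

/-- The differential of a rational polynomial function. -/
lemma hasStrictFDerivAt_aeval {σ : Type*} [Fintype σ] [DecidableEq σ] (a : σ → ℝ)
    (p : MvPolynomial σ ℚ) :
    HasStrictFDerivAt (fun x : σ → ℝ => aeval x p)
      (∑ n, polyGradQ p a n • (ContinuousLinearMap.proj n : (σ → ℝ) →L[ℝ] ℝ)) a := by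
  induction p using MvPolynomial.induction_on with
  | C r => simpa [polyGradQ] using hasStrictFDerivAt_const (𝕜 := ℝ) (algebraMap ℚ ℝ r) a
  | add p q hp hq =>
    have hd : ∑ n, polyGradQ (p + q) a n • (ContinuousLinearMap.proj n : (σ → ℝ) →L[ℝ] ℝ) =
        ∑ n, polyGradQ p a n • (ContinuousLinearMap.proj n : (σ → ℝ) →L[ℝ] ℝ) +
          ∑ n, polyGradQ q a n • (ContinuousLinearMap.proj n : (σ → ℝ) →L[ℝ] ℝ) := by
      simp only [map_add, polyGradQ, add_smul, Finset.sum_add_distrib]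
    simp only [hd, map_add]
    exact hp.add hq
  | mul_X p i hp =>
    have hd : ∑ n, polyGradQ (p * X i) a n • (ContinuousLinearMap.proj n : (σ → ℝ) →L[ℝ] ℝ) =
        (aeval a p : ℝ) • (ContinuousLinearMap.proj i : (σ → ℝ) →L[ℝ] ℝ) +
          a i • ∑ n, polyGradQ p a n • (ContinuousLinearMap.proj n : (σ → ℝ) →L[ℝ] ℝ) := by
      simp only [polyGradQ_mul_X, add_smul, Finset.sum_add_distrib, ite_smul, zero_smul,
        Finset.sum_ite_eq', Finset.mem_univ, if_true, Finset.smul_sum, smul_smul]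
      simp only [mul_comm, add_comm]
    simp only [hd, map_mul, aeval_X]
    exact hp.mul (ContinuousLinearMap.proj (R := ℝ) (φ := fun _ : σ => ℝ) i).hasStrictFDerivAt

lemma continuous_aeval_rat {σ : Type*} (p : MvPolynomial σ ℚ) :
    Continuous fun x : σ → ℝ => aeval x p := by
  have := continuous_eval (MvPolynomial.map (algebraMap ℚ ℝ) p)
  simpa only [eval_map, ← aeval_def] using this

lemma IsQAlgebraicSet.isClosed {σ : Type*} {V : Set (σ → ℝ)} (hV : IsQAlgebraicSet V) :
    IsClosed V := by
  obtain ⟨S, rfl⟩ := hV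
  simp only [Set.ofPred_forall]
  exact isClosed_biInter fun p _ => isClosed_eq (continuous_aeval_rat p) continuous_const

/-- A linearly independent finite family of row vectors has a dual family. -/
lemma exists_dual_family {σ : Type*} [Fintype σ] {c : ℕ} {A : Matrix (Fin c) σ ℝ}
    (hA : LinearIndependent ℝ A.row) :
    LinearMap.range A.mulVecLin = ⊤ ∧
      ∃ w : Fin c → σ → ℝ, ∀ i j, ∑ n, A i n * w j n = if i = j then 1 else 0 := by
  classical
  have htop : LinearMap.range A.mulVecLin = ⊤ := by
    refine Submodule.eq_top_of_finrank_eq ?_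
    have := hA.rank_matrix
    rw [Matrix.rank] at this
    simpa using this
  refine ⟨htop, ?_⟩
  have hs := LinearMap.range_eq_top.mp htop
  choose w hw using fun j : Fin c => hs (Pi.single j 1)
  refine ⟨w, fun i j => ?_⟩
  have := congrFun (hw j) i
  simpa [Matrix.mulVec, dotProduct, Pi.single_apply] using this

/-- A regular system of polynomial equations admits solution curves tangent to every vector in
the kernel of its differential. -/
lemma exists_curve_of_linearIndependent {σ : Type*} [Fintype σ] [DecidableEq σ] {c : ℕ}
    {r : Fin c → MvPolynomial σ ℚ} {a : σ → ℝ} (hra : ∀ i, aeval a (r i) = 0)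
    (hr : LinearIndependent ℝ fun j => polyGradQ (r j) a) {v : σ → ℝ}
    (hv : ∀ i, ∑ n, polyGradQ (r i) a n * v n = 0) :
    ∃ γ : ℝ → σ → ℝ, γ 0 = a ∧ HasDerivAt γ v 0 ∧
      ∀ᶠ t in 𝓝 (0 : ℝ), ∀ i, aeval (γ t) (r i) = 0 := by
  let f : (σ → ℝ) → Fin c → ℝ := fun x i => aeval x (r i)
  let f' : (σ → ℝ) →L[ℝ] (Fin c → ℝ) := ContinuousLinearMap.pi fun i =>
    ∑ n, polyGradQ (r i) a n • (ContinuousLinearMap.proj n : (σ → ℝ) →L[ℝ] ℝ)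
  have hf : HasStrictFDerivAt f f' a :=
    hasStrictFDerivAt_pi.mpr fun i => hasStrictFDerivAt_aeval a (r i)
  have hf'apply : ∀ x i, f' x i = ∑ n, polyGradQ (r i) a n * x n := by
    intro x i
    simp [f']
  have hf' : f'.range = ⊤ := by
    have h := (exists_dual_family (A := Matrix.of fun j => polyGradQ (r j) a) hr).1
    rw [LinearMap.range_eq_top] at h ⊢
    intro y
    obtain ⟨x, hx⟩ := h y
    refine ⟨x, ?_⟩
    rw [← hx]
    ext i
    exact hf'apply x i
  have hfa : f a = 0 := funext hra
  let v' : f'.ker := ⟨v, by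
    rw [LinearMap.mem_ker]
    ext i
    exact (hf'apply v i).trans (hv i)⟩
  have hline : HasDerivAt (fun t : ℝ => t • v') v' 0 := by
    simpa using (hasDerivAt_id (0 : ℝ)).smul_const v'
  refine ⟨fun t => hf.implicitFunction f f' hf' (f a) (t • v'), ?_, ?_, ?_⟩
  · simp
  · have h := (hf.to_implicitFunction hf').hasFDerivAt
    rw [← zero_smul ℝ v'] at h
    exact h.comp_hasDerivAt (0 : ℝ) hline
  · have h := hf.map_implicitFunction_eq hf'
    have htend : Tendsto (fun t : ℝ => (f a, t • v')) (𝓝 0) (𝓝 (f a, 0)) := by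
      have hl : Tendsto (fun t : ℝ => t • v') (𝓝 0) (𝓝 0) := by
        simpa using hline.continuousAt.tendsto
      exact tendsto_const_nhds.prodMk_nhds hl
    filter_upwards [htend.eventually h] with t ht i
    exact congrFun (ht.trans hfa) i

/-- Linearly independent families of the same size with nested kernels have equal kernels. -/
lemma ker_le_of_ker_le {σ : Type*} [Fintype σ] {c : ℕ} {A B : Matrix (Fin c) σ ℝ}
    (hA : LinearIndependent ℝ A.row) (hB : LinearIndependent ℝ B.row)
    (h : LinearMap.ker A.mulVecLin ≤ LinearMap.ker B.mulVecLin) :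
    LinearMap.ker B.mulVecLin ≤ LinearMap.ker A.mulVecLin := by
  refine (Submodule.eq_of_le_of_finrank_eq h ?_).ge
  have h1 := LinearMap.finrank_range_add_finrank_ker A.mulVecLin
  have h2 := LinearMap.finrank_range_add_finrank_ker B.mulVecLin
  rw [(exists_dual_family hA).1] at h1
  rw [(exists_dual_family hB).1] at h2
  omega

/-- Let `Z` be regularly cut out near `a` by `r`, and let `q` be equally many polynomials vanishing
on `Z` with independent gradients at `a`. Then `q` generates the ideal of `Z` locally at `a`. -/
lemma exists_mul_mem_span_of_regular {σ : Type*} [Fintype σ] [DecidableEq σ] {c : ℕ}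
    {Z U : Set (σ → ℝ)} {a : σ → ℝ} (ha : a ∈ Z) (hU : IsOpen U) (haU : a ∈ U)
    {q r : Fin c → MvPolynomial σ ℚ}
    (hq : ∀ i, ∀ x ∈ Z, aeval x (q i) = 0) (hr : ∀ i, ∀ x ∈ Z, aeval x (r i) = 0)
    (hq' : LinearIndependent ℝ fun j => polyGradQ (q j) a)
    (hr' : LinearIndependent ℝ fun j => polyGradQ (r j) a)
    (hZU : Z ∩ U = {x ∈ U | ∀ j, aeval x (r j) = 0})
    {g : MvPolynomial σ ℚ} (hg : ∀ x ∈ Z, aeval x g = 0) :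
    ∃ h : MvPolynomial σ ℚ, aeval a h ≠ 0 ∧ h * g ∈ Ideal.span (Set.range q) := by
  have hcurve : ∀ v : σ → ℝ, (∀ i, ∑ n, polyGradQ (r i) a n * v n = 0) →
      ∃ γ : ℝ → σ → ℝ, γ 0 = a ∧ HasDerivAt γ v 0 ∧ ∀ᶠ t in 𝓝 (0 : ℝ), γ t ∈ Z := by
    intro v hv
    obtain ⟨γ, h0, hγ, hz⟩ := exists_curve_of_linearIndependent (fun i => hr i a ha) hr' hv
    refine ⟨γ, h0, hγ, ?_⟩
    have hγU : ∀ᶠ t in 𝓝 (0 : ℝ), γ t ∈ U :=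
      hγ.continuousAt.eventually (by rw [h0]; exact hU.mem_nhds haU)
    filter_upwards [hz, hγU] with t ht htU
    exact (hZU.ge ⟨htU, ht⟩).1
  have hker : LinearMap.ker (Matrix.of fun j => polyGradQ (q j) a).mulVecLin ≤
      LinearMap.ker (Matrix.of fun j => polyGradQ (r j) a).mulVecLin := by
    refine ker_le_of_ker_le hr' hq' fun v hv => ?_
    obtain ⟨γ, h0, hγ, hz⟩ := hcurve v fun i => congrFun hv i
    rw [LinearMap.mem_ker]
    ext i
    have hd := (hasStrictFDerivAt_aeval a (q i)).hasFDerivAt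
    rw [← h0] at hd
    have hd := hd.comp_hasDerivAt (0 : ℝ) hγ
    have h0' : HasDerivAt ((fun x : σ → ℝ => aeval x (q i)) ∘ γ) 0 0 := by
      refine (hasDerivAt_const (0 : ℝ) (0 : ℝ)).congr_of_eventuallyEq ?_
      filter_upwards [hz] with t ht
      exact hq i _ ht
    have := hd.unique h0'
    rw [h0] at this
    simpa [Matrix.mulVec, dotProduct] using this
  obtain ⟨-, w, hw⟩ := exists_dual_family (A := Matrix.of fun j => polyGradQ (q j) a) hq'
  obtain ⟨h, h1, hmem⟩ := exists_mul_mem_span_of_curves (fun i => shiftAt a (q i)) (shiftAt a g)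
    (fun i => polyGradQ (q i) a) w hw
    (fun i => by simpa [hq i a ha] using shiftAt_sub_linear_mem a (q i))
    (fun v hv => by
      have hv' := hker (x := v) (by
        rw [LinearMap.mem_ker]
        ext i
        exact hv i)
      obtain ⟨γ, h0, hγ, hz⟩ := hcurve v fun i => congrFun hv' i
      refine ⟨fun t => t⁻¹ • (γ t - a), ?_, ?_⟩
      · have := hasDerivAt_iff_tendsto_slope_zero.mp hγ
        simpa [h0] using this
      · filter_upwards [hz.filter_mono nhdsWithin_le_nhds, self_mem_nhdsWithin] with t ht ht0
        have ht0 : t ≠ 0 := ht0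
        simp only [smul_inv_smul₀ ht0, eval_shiftAt, sub_add_cancel]
        exact ⟨hg _ ht, fun i => hq i _ ht⟩)
  let τ : MvPolynomial σ ℝ →ₐ[ℝ] MvPolynomial σ ℝ := aeval fun i => X i - C (a i)
  have hτ : ∀ p, τ (shiftAt a p) = MvPolynomial.map (algebraMap ℚ ℝ) p := by
    intro p
    induction p using MvPolynomial.induction_on with
    | C r => simp [shiftAt, τ]
    | add p q hp hq => rw [map_add, map_add, map_add, hp, hq]
    | mul_X p i hp => rw [map_mul, map_mul, map_mul, hp]; simp [shiftAt, τ]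
  have hτa : ∀ p, eval a (τ p) = constantCoeff p := by
    intro p
    induction p using MvPolynomial.induction_on with
    | C r => simp [τ]
    | add p q hp hq => rw [map_add, map_add, map_add, hp, hq]
    | mul_X p i hp => rw [map_mul, map_mul, map_mul, hp]; simp [τ]
  refine exists_rat_mul_mem_span q g a (τ h) (by rw [hτa, h1]; exact one_ne_zero) ?_
  have := Ideal.mem_map_of_mem τ hmem
  rw [Ideal.map_span, ← Set.range_comp, map_mul, hτ] at this
  simpa only [Function.comp_def, hτ] using this

/-- Around each point of `Z`, some rational polynomial vanishing on `V \ Z` does not vanish. -/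
lemma exists_vanishing_sdiff {σ : Type*} [Fintype σ] [DecidableEq σ] {d : ℕ} {V Z : Set (σ → ℝ)}
    (hV : IsQNonsingular d V) (hZ : IsQNonsingular d Z) (hZV : Z ⊆ V) {a : σ → ℝ} (ha : a ∈ Z) :
    ∃ h : MvPolynomial σ ℚ, aeval a h ≠ 0 ∧ ∀ x ∈ V \ Z, aeval x h = 0 := by
  obtain ⟨q, hq, hq', -⟩ := hV.2.2 a (hZV ha)
  obtain ⟨r, hr, hr', U, hU, haU, hZU⟩ := hZ.2.2 a ha
  obtain ⟨S, hS⟩ := hZ.1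
  have hgZ : ∀ x : σ → ℝ, aeval x (∑ p ∈ S, p ^ 2) = 0 ↔ x ∈ Z := by
    intro x
    rw [hS, map_sum]
    simp only [map_pow]
    rw [Finset.sum_eq_zero_iff_of_nonneg fun p _ => sq_nonneg _]
    simp
  obtain ⟨h, hha, hmem⟩ := exists_mul_mem_span_of_regular ha hU haU
    (fun i x hx => hq i x (hZV hx)) hr hq' hr' hZU (fun x hx => (hgZ x).mpr hx)
  refine ⟨h, hha, fun x hx => ?_⟩
  have hle : Ideal.span (Set.range q) ≤ RingHom.ker (aeval (R := ℚ) x) := Ideal.span_le.mpr (by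
    rintro _ ⟨i, rfl⟩
    exact hq i x hx.1)
  have h0 : aeval x (h * ∑ p ∈ S, p ^ 2) = 0 := hle hmem
  rw [map_mul] at h0
  exact (mul_eq_zero.mp h0).resolve_right fun hg => hx.2 ((hgZ x).mp hg)

/-- The difference of nested `ℚ`-nonsingular sets of the same dimension is `ℚ`-algebraic. -/
lemma isQAlgebraicSet_sdiff {σ : Type*} [Fintype σ] [DecidableEq σ] {d : ℕ} {V Z : Set (σ → ℝ)}
    (hV : IsQNonsingular d V) (hZ : IsQNonsingular d Z) (hZV : Z ⊆ V) :
    IsQAlgebraicSet (V \ Z) := by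
  let I : Ideal (MvPolynomial σ ℚ) := ⨅ x ∈ V \ Z, RingHom.ker (aeval (R := ℚ) x)
  have hI : ∀ p, p ∈ I ↔ ∀ x ∈ V \ Z, aeval x p = 0 := by
    intro p
    simp only [I, Ideal.mem_iInf, RingHom.mem_ker]
  obtain ⟨S, hS⟩ := IsNoetherian.noetherian I
  refine ⟨S, Set.Subset.antisymm (fun x hx p hp => ?_) fun x hx => ?_⟩
  · exact (hI p).mp (hS ▸ Submodule.subset_span hp) x hx
  · have hxI : ∀ p ∈ I, aeval x p = 0 := by
      have : I ≤ RingHom.ker (aeval (R := ℚ) x) := hS ▸ Ideal.span_le.mpr hx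
      exact fun p hp => this hp
    obtain ⟨T, hT⟩ := hV.1
    refine ⟨?_, fun hxZ => ?_⟩
    · rw [hT]
      intro p hp
      refine hxI p ((hI p).mpr fun y hy => ?_)
      have := hy.1
      rw [hT] at this
      exact this p hp
    · obtain ⟨h, hne, h0⟩ := exists_vanishing_sdiff hV hZ hZV hxZ
      exact hne (hxI h ((hI h).mpr h0))

/-- **Separation of components over `ℚ`.** -/
theorem qNonsingular_sdiff
    {N d : ℕ} (V Z : Set (Fin N → ℝ))
    (hV : IsQNonsingular d V) (hZ : IsQNonsingular d Z)
    (hZV : Z ⊆ V) (hne : Z ≠ V) :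
    IsQNonsingular d (V \ Z) ∧ IsClosed (V \ Z) ∧ IsQAlgebraicSet (V \ Z) := by
  have halg := isQAlgebraicSet_sdiff hV hZ hZV
  have hZo : IsOpen Zᶜ := hZ.1.isClosed.isOpen_compl
  refine ⟨⟨halg, ?_, ?_⟩, halg.isClosed, halg⟩
  · intro a ha
    obtain ⟨U, f, hU, haU, hf, hsurj, hVU⟩ := hV.2.1 a ha.1
    refine ⟨U ∩ Zᶜ, f, hU.inter hZo, ⟨haU, ha.2⟩, hf.mono Set.inter_subset_left,
      fun x hx => hsurj x hx.1, ?_⟩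
    ext x
    have := Set.ext_iff.mp hVU x
    simp only [Set.mem_inter_iff, Set.mem_sdiff, Set.mem_compl_iff, Set.mem_ofPred_eq] at this ⊢
    tauto
  · intro a ha
    obtain ⟨q, hq, hq', U, hU, haU, hVU⟩ := hV.2.2 a ha.1
    refine ⟨q, fun j x hx => hq j x hx.1, hq', U ∩ Zᶜ, hU.inter hZo, ⟨haU, ha.2⟩, ?_⟩
    ext x
    have := Set.ext_iff.mp hVU x
    simp only [Set.mem_inter_iff, Set.mem_sdiff, Set.mem_compl_iff, Set.mem_ofPred_eq] at this ⊢
    tauto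
end
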